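/- arXiv:1805.10894 — 2 statements merged into one kernel-verified Lean document; each statement's English description precedes it below -/
import Mathlib

section
/- For every prime p there is an element α_p of the free Lie ℤ-algebra L (on x_0, …, x_{2p−2}, with x_{2p−1} := −(x_0 + ⋯ + x_{2p−2})) with the following properties: (i) the image of α_p in U(L) lies in (𝔦_0, …, 𝔦_{2p−1})_Σ; (ii) α_p ∉ [I_0, …, I_{2p−1}]_Σ; (iii) p·α_p ∈ [I_0, …, I_{2p−1}]_Σ; and furthermore (iv) the image of α_p in U(L) lies in the sum over all ρ ∈ Sym({0,…,2p−1}) of the products [𝔦_{ρ(0)}, 𝔦_{ρ(1)}]·[𝔦_{ρ(2)}, 𝔦_{ρ(3)}]·⋯·[𝔦_{ρ(2p−2)}, 𝔦_{ρ(2p−1)}], where [𝔦, 𝔧] denotes the additive subgroup of U(L) spanned by {ab − ba : a ∈ 𝔦, b ∈ 𝔧}. -/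
variable (p : ℕ)

/-- The elements `x_0, …, x_{2p-1}` of the free Lie `ℤ`-algebra `L` on `x_0, …, x_{2p-2}`,
with `x_{2p-1} := -(x_0 + ⋯ + x_{2p-2})`, so that `x_0 + x_1 + ⋯ + x_{2p-1} = 0`. -/
noncomputable def xL (i : Fin (2 * p)) : FreeLieAlgebra ℤ (Fin (2 * p - 1)) :=
  if h : (i : ℕ) < 2 * p - 1 then FreeLieAlgebra.of ℤ ⟨i, h⟩
  else -(∑ j : Fin (2 * p - 1), FreeLieAlgebra.of ℤ j)

/-- `I_i`, the Lie ideal of `L` generated by `x_i`. -/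
noncomputable def ILie (i : Fin (2 * p)) :
    LieIdeal ℤ (FreeLieAlgebra ℤ (Fin (2 * p - 1))) :=
  LieSubmodule.lieSpan ℤ (FreeLieAlgebra ℤ (Fin (2 * p - 1))) {xL p i}

/-- `𝔦_i`, the two-sided ideal of `U(L)` generated by the image of `x_i`, viewed as
a `ℤ`-submodule of `U(L)`. -/
noncomputable def iIdeal (i : Fin (2 * p)) :
    Submodule ℤ (UniversalEnvelopingAlgebra ℤ (FreeLieAlgebra ℤ (Fin (2 * p - 1)))) :=
  Submodule.span ℤ
    {v | ∃ a b : UniversalEnvelopingAlgebra ℤ (FreeLieAlgebra ℤ (Fin (2 * p - 1))),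
      v = a * (UniversalEnvelopingAlgebra.ι ℤ (xL p i)) * b}

/-- The symmetric product `(𝔦_0, …, 𝔦_{2p-1})_Σ = Σ_ρ 𝔦_{ρ(0)} ⋯ 𝔦_{ρ(2p-1)}`. -/
noncomputable def symProdLie :
    Submodule ℤ (UniversalEnvelopingAlgebra ℤ (FreeLieAlgebra ℤ (Fin (2 * p - 1)))) :=
  ⨆ ρ : Equiv.Perm (Fin (2 * p)),
    (List.ofFn fun k : Fin (2 * p) => iIdeal p (ρ k)).prod

/-- Left-normed iterated bracket of a list of Lie ideals. -/
def leftBracketIdeal {R L : Type*} [CommRing R] [LieRing L] [LieAlgebra R L] :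
    List (LieIdeal R L) → LieIdeal R L
  | [] => ⊥
  | a :: l => l.foldl (fun x y => ⁅x, y⁆) a

/-- The symmetric commutator `[I_0, …, I_{2p-1}]_Σ`, the sum of the left-normed brackets
`[I_{ρ(0)}, …, I_{ρ(2p-1)}]` over all permutations `ρ`. -/
noncomputable def symCommLie : LieIdeal ℤ (FreeLieAlgebra ℤ (Fin (2 * p - 1))) :=
  ⨆ ρ : Equiv.Perm (Fin (2 * p)),
    leftBracketIdeal (List.ofFn fun k : Fin (2 * p) => ILie p (ρ k))

/-- `[𝔦, 𝔧]`, the additive subgroup (ℤ-submodule) spanned by `{ab - ba : a ∈ 𝔦, b ∈ 𝔧}`. -/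
noncomputable def submoduleComm {R : Type*} [Ring R] (r s : Submodule ℤ R) : Submodule ℤ R :=
  Submodule.span ℤ {x | ∃ a ∈ r, ∃ b ∈ s, x = a * b - b * a}

/-- The sum over all `ρ` of `[𝔦_{ρ(0)}, 𝔦_{ρ(1)}]·[𝔦_{ρ(2)}, 𝔦_{ρ(3)}]⋯[𝔦_{ρ(2p-2)}, 𝔦_{ρ(2p-1)}]`. -/
noncomputable def symCommProdLie :
    Submodule ℤ (UniversalEnvelopingAlgebra ℤ (FreeLieAlgebra ℤ (Fin (2 * p - 1)))) :=
  ⨆ ρ : Equiv.Perm (Fin (2 * p)),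
    (List.ofFn fun k : Fin p =>
      submoduleComm (iIdeal p (ρ ⟨2 * k, by omega⟩))
        (iIdeal p (ρ ⟨2 * k + 1, by omega⟩))).prod


namespace SerreLie

section ringpart
variable {R : Type*} [Ring R]

/-- `∑_{i+j+1=a} E^i t E^j` -/
def Kf (E t : R) : ℕ → R
  | 0 => 0
  | a + 1 => E * Kf E t a + t * E ^ a

lemma Kf_succ' (E t : R) (a : ℕ) : Kf E t (a + 1) = Kf E t a * E + E ^ a * t := by
  induction a with
  | zero => simp [Kf]
  | succ a ih =>
    have h1 : Kf E t (a + 1) = E * Kf E t a + t * E ^ a := rfl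
    rw [show Kf E t (a + 1 + 1) = E * Kf E t (a + 1) + t * E ^ (a + 1) from rfl]
    nth_rewrite 1 [ih]
    rw [h1]
    nth_rewrite 1 [pow_succ E a]
    rw [pow_succ' E a]
    noncomm_ring

lemma Kf_add (E t t' : R) (a : ℕ) : Kf E (t + t') a = Kf E t a + Kf E t' a := by
  induction a with
  | zero => simp [Kf]
  | succ a ih => rw [Kf, ih, Kf, Kf]; noncomm_ring

/-- formal `D(E^a f E^b)`. -/
def Pf (E f : R) (a b : ℕ) : R := Kf E f a * f * E ^ b - E ^ a * f * Kf E f b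

def Nf (E f f' g : R) (a b : ℕ) : R :=
  -(Kf E f' a * f * E ^ b) - E ^ a * g * E ^ b + E ^ a * f * Kf E f' b

lemma Pf_succ_left (E f : R) (a b : ℕ) :
    Pf E f (a + 1) b = E * Pf E f a b + f * E ^ a * f * E ^ b := by
  simp only [Pf, Kf, pow_succ' E a]; noncomm_ring

lemma Pf_succ_right (E f : R) (a b : ℕ) :
    Pf E f a (b + 1) = Pf E f a b * E - E ^ a * f * E ^ b * f := by
  simp only [Pf, Kf_succ', pow_succ E b]; noncomm_ring

/-- iterated commutator -/
def Ad (E f : R) : ℕ → R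
  | 0 => f
  | a + 1 => E * Ad E f a - Ad E f a * E

open Finset

lemma Z_zero (E f : R) (k : ℕ) :
    ∑ b ∈ range (k + 1), Pf E f (k - b) b = 0 := by
  induction k with
  | zero => simp [Pf, Kf]
  | succ k ih =>
    rw [sum_range_succ]
    have h1 : ∀ b ∈ range (k + 1), Pf E f (k + 1 - b) b
        = E * Pf E f (k - b) b + f * (E ^ (k - b) * f * E ^ b) := by
      intro b hb
      have : k + 1 - b = (k - b) + 1 := by have := mem_range.1 hb; omega
      rw [this, Pf_succ_left]; noncomm_ring
    rw [sum_congr rfl h1, sum_add_distrib, ← mul_sum, ih, ← mul_sum]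
    have h2 : ∀ k, ∑ b ∈ range (k + 1), E ^ (k - b) * f * E ^ b = Kf E f (k + 1) := by
      intro k
      induction k with
      | zero => simp [Kf]
      | succ k ih =>
        rw [sum_range_succ]
        have h1 : ∀ b ∈ range (k + 1), E ^ (k + 1 - b) * f * E ^ b
            = E * (E ^ (k - b) * f * E ^ b) := by
          intro b hb
          have : k + 1 - b = (k - b) + 1 := by have := mem_range.1 hb; omega
          rw [this, pow_succ' E (k - b)]; noncomm_ring
        rw [sum_congr rfl h1, ← mul_sum, ih]
        simp [Kf]
    rw [h2]
    simp [Pf, Kf]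

/-- Pascal type summation. -/
lemma pascal_sum {M : Type*} [AddCommGroup M] (k : ℕ) (G : ℕ → M) :
    ∑ b ∈ range (k + 2), (((-1 : ℤ) ^ b * (k + 1).choose b) • G b)
      = ∑ b ∈ range (k + 1), (((-1 : ℤ) ^ b * k.choose b) • (G b - G (b + 1))) := by
  simp only [smul_sub, sum_sub_distrib]
  rw [sum_range_succ' _ (k + 1)]
  have : ∀ b, ((-1 : ℤ) ^ (b + 1) * (k + 1).choose (b + 1)) • G (b + 1)
      = ((-1 : ℤ) ^ (b + 1) * k.choose (b + 1)) • G (b + 1)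
        - ((-1 : ℤ) ^ b * k.choose b) • G (b + 1) := by
    intro b
    rw [Nat.choose_succ_succ, ← sub_smul]
    congr 1; push_cast; ring
  simp only [this, sum_sub_distrib]
  rw [sum_range_succ' (fun b => ((-1 : ℤ) ^ b * k.choose b) • G b) k]
  rw [sum_range_succ _ k]
  simp
  abel

lemma Ad_eq (E f : R) (k : ℕ) :
    Ad E f k = ∑ b ∈ range (k + 1), (((-1 : ℤ) ^ b * k.choose b) • (E ^ (k - b) * f * E ^ b)) := by
  induction k with
  | zero => simp [Ad]
  | succ k ih =>
    rw [pascal_sum, Ad, ih, mul_sum, sum_mul, ← sum_sub_distrib]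
    refine sum_congr rfl fun b hb => ?_
    have h1 : k + 1 - b = (k - b) + 1 := by have := mem_range.1 hb; omega
    have h2 : k + 1 - (b + 1) = k - b := by omega
    rw [h1, h2, mul_smul_comm, smul_mul_assoc, ← smul_sub, pow_succ' E (k - b), pow_succ E b]
    congr 1
    noncomm_ring

def Qf (E f : R) (k : ℕ) : R :=
  ∑ b ∈ range (k + 1), (((-1 : ℤ) ^ b * k.choose b) • Pf E f (k - b) b)

lemma Qf_succ (E f : R) (k : ℕ) :
    Qf E f (k + 1) = E * Qf E f k - Qf E f k * E + f * Ad E f k + Ad E f k * f := by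
  rw [Qf, pascal_sum, Qf, Ad_eq]
  simp only [mul_sum, sum_mul]
  rw [← sum_sub_distrib, ← sum_add_distrib, ← sum_add_distrib]
  refine sum_congr rfl fun b hb => ?_
  have h1 : k + 1 - b = (k - b) + 1 := by have := mem_range.1 hb; omega
  have h2 : k + 1 - (b + 1) = k - b := by omega
  rw [h1, h2]
  simp only [mul_smul_comm, smul_mul_assoc, ← smul_sub, ← smul_add]
  congr 1
  rw [Pf_succ_left, Pf_succ_right]
  noncomm_ring

lemma Qf_eq (E f : R) (k : ℕ) :
    Qf E f k = ∑ i ∈ range k, ((k + 1).choose (i + 1)) • (Ad E f i * Ad E f (k - 1 - i)) := by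
  induction k with
  | zero => simp [Qf, Pf, Kf]
  | succ k ih =>
    rw [Qf_succ, ih, mul_sum, sum_mul, ← sum_sub_distrib]
    have h : ∀ i ∈ range k, E * (((k + 1).choose (i + 1)) • (Ad E f i * Ad E f (k - 1 - i)))
        - (((k + 1).choose (i + 1)) • (Ad E f i * Ad E f (k - 1 - i))) * E
        = ((k + 1).choose (i + 1)) • (Ad E f (i + 1) * Ad E f (k - (i + 1)))
          + ((k + 1).choose (i + 1)) • (Ad E f i * Ad E f (k - i)) := by
      intro i hi
      have h1 : k - i = (k - 1 - i) + 1 := by have := mem_range.1 hi; omega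
      have h2 : k - (i + 1) = k - 1 - i := by omega
      rw [h1, h2, mul_smul_comm, smul_mul_assoc, ← smul_sub, ← smul_add]
      congr 1
      simp only [Ad]; noncomm_ring
    rw [sum_congr rfl h, sum_add_distrib]
    have e : ∀ i, (k + 1 + 1).choose (i + 1) • (Ad E f i * Ad E f (k + 1 - 1 - i))
        = (k + 1).choose i • (Ad E f i * Ad E f (k - i))
          + (k + 1).choose (i + 1) • (Ad E f i * Ad E f (k - i)) := by
      intro i
      rw [Nat.choose_succ_succ (k + 1) i, add_smul]; rfl
    simp only [e, sum_add_distrib]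
    rw [sum_range_succ' (fun i => (k + 1).choose i • (Ad E f i * Ad E f (k - i)))]
    rw [sum_range_succ (fun i => (k + 1).choose (i + 1) • (Ad E f i * Ad E f (k - i)))]
    simp [Ad]
    abel

end ringpart

/-- `((-1)^b C(p-1,b) - 1)/p` -/
def cb (p b : ℕ) : ℤ := ((-1 : ℤ) ^ b * (p - 1).choose b - 1) / p

def qk (p k : ℕ) : ℕ := p.choose (k + 1) / p

lemma cb_spec {p : ℕ} (hp : p.Prime) {b : ℕ} (hb : b < p) :
    (p : ℤ) * cb p b = (-1 : ℤ) ^ b * (p - 1).choose b - 1 := by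
  rw [cb]
  apply Int.mul_ediv_cancel'
  have key : ∀ b : ℕ, b < p → (p : ℤ) ∣ (-1 : ℤ) ^ b * (p - 1).choose b - 1 := by
    intro b
    induction b with
    | zero => intro _; simp
    | succ b ih =>
      intro hb
      have h1 := ih (by omega)
      have h2 : (p : ℤ) ∣ p.choose (b + 1) := by
        exact_mod_cast hp.dvd_choose_self (by omega) hb
      have h3 : p.choose (b + 1) = (p - 1).choose b + (p - 1).choose (b + 1) := by
        obtain ⟨q, rfl⟩ : ∃ q, p = q + 1 := ⟨p - 1, by omega⟩
        exact Nat.choose_succ_succ q b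
      have : (-1 : ℤ) ^ (b + 1) * (p - 1).choose (b + 1) - 1
          = (-1 : ℤ) ^ (b + 1) * p.choose (b + 1) + ((-1 : ℤ) ^ b * (p - 1).choose b - 1) := by
        rw [h3]; push_cast; ring
      rw [this]
      exact dvd_add (h2.mul_left _) h1
  exact key b hb

lemma qk_spec {p : ℕ} (hp : p.Prime) {k : ℕ} (hk : k + 1 < p) :
    p * qk p k = p.choose (k + 1) :=
  Nat.mul_div_cancel' (hp.dvd_choose_self (by omega) hk)

lemma sum_cb {p : ℕ} (hp : p.Prime) : ∑ b ∈ Finset.range p, cb p b = -1 := by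
  have h : (p : ℤ) * ∑ b ∈ Finset.range p, cb p b = p * (-1) := by
    rw [Finset.mul_sum, Finset.sum_congr rfl (fun b hb => cb_spec hp (Finset.mem_range.1 hb)),
      Finset.sum_sub_distrib]
    have := Int.alternating_sum_range_choose (n := p - 1)
    have e : p - 1 + 1 = p := by have := hp.two_le; omega
    rw [e] at this
    rw [this]
    have : p - 1 ≠ 0 := by have := hp.two_le; omega
    simp [this]
  exact mul_left_cancel₀ (by exact_mod_cast hp.ne_zero) h

open Finset in
lemma h_identity {R : Type*} [Ring R] {p : ℕ} (hp : p.Prime) (E f : R) :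
    ∑ k ∈ range (p - 1), qk p k • (Ad E f k * Ad E f (p - 2 - k))
      = ∑ b ∈ range p, cb p b • Pf E f (p - 1 - b) b := by
  have e : p - 1 + 1 = p := by have := hp.two_le; omega
  -- free case
  have free : ∀ E f : FreeAlgebra ℤ Bool,
      ∑ k ∈ range (p - 1), qk p k • (Ad E f k * Ad E f (p - 2 - k))
      = ∑ b ∈ range p, cb p b • Pf E f (p - 1 - b) b := by
    intro E f
    have hne : (p : FreeAlgebra ℤ Bool) ≠ 0 := by
      intro h
      have h2 : algebraMap ℤ (FreeAlgebra ℤ Bool) p = algebraMap ℤ (FreeAlgebra ℤ Bool) 0 := by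
        simpa using h
      have := FreeAlgebra.algebraMap_leftInverse.injective h2
      exact hp.ne_zero (by exact_mod_cast this)
    apply mul_left_cancel₀ hne
    have h1 : (p : FreeAlgebra ℤ Bool) * ∑ k ∈ range (p - 1),
        qk p k • (Ad E f k * Ad E f (p - 2 - k)) = Qf E f (p - 1) := by
      rw [Qf_eq, mul_sum]
      refine sum_congr rfl fun k hk => ?_
      rw [e, ← qk_spec hp (k := k) (by have := mem_range.1 hk; omega), mul_smul, ← nsmul_eq_mul]
      rfl
    have h2 : (p : FreeAlgebra ℤ Bool) * ∑ b ∈ range p, cb p b • Pf E f (p - 1 - b) b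
        = Qf E f (p - 1) := by
      have hz := Z_zero E f (p - 1)
      rw [Qf, mul_sum, e]
      rw [e] at hz
      rw [← sub_zero (∑ b ∈ range p, _ • Pf E f (p - 1 - b) b), ← hz, ← sum_sub_distrib]
      refine sum_congr rfl fun b hb => ?_
      have h3 := cb_spec hp (mem_range.1 hb)
      have h4 : (-1 : ℤ) ^ b * (p - 1).choose b = p * cb p b + 1 := by rw [h3]; ring
      rw [h4, add_smul, one_smul, mul_smul, add_sub_cancel_right]
      rw [natCast_zsmul, nsmul_eq_mul]
    rw [h1, h2]
  have := congrArg (FreeAlgebra.lift ℤ (fun b : Bool => if b then E else f))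
    (free (FreeAlgebra.ι ℤ true) (FreeAlgebra.ι ℤ false))
  set F := FreeAlgebra.lift ℤ (fun b : Bool => if b then E else f) with hF
  have hE : F (FreeAlgebra.ι ℤ true) = E := by simp [hF]
  have hf : F (FreeAlgebra.ι ℤ false) = f := by simp [hF]
  have hK : ∀ (E' t : FreeAlgebra ℤ Bool) a, F (Kf E' t a) = Kf (F E') (F t) a := by
    intro E' t a
    induction a with
    | zero => simp [Kf]
    | succ a ih => simp [Kf, ih]
  have hAd : ∀ (E' t : FreeAlgebra ℤ Bool) a, F (Ad E' t a) = Ad (F E') (F t) a := by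
    intro E' t a
    induction a with
    | zero => simp [Ad]
    | succ a ih => simp [Ad, ih]
  simpa only [map_sum, map_nsmul, map_zsmul, map_mul, hAd, hE, hf, Pf, map_sub, hK, map_pow]
    using this

section Dpart
variable {R : Type*} [Ring R] (D : R →+ R) (u y z s : R)

/-- The D relations. -/
structure DRel : Prop where
  hu : ∀ X, D (u * X) = s * X - u * D X
  hy : ∀ X, D (y * X) = y * D X
  hz : ∀ X, D (z * X) = z * D X
  h1 : D 1 = 0
  hs : s + y + z = 0

variable {D u y z s}

lemma DRel.hE (h : DRel D u y z s) (X : R) :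
    D (u ^ 2 * X) = ((u * y - y * u) + (u * z - z * u)) * X + u ^ 2 * D X := by
  have hs : s = -y - z := by have := h.hs; rw [add_assoc] at this; rw [eq_neg_of_add_eq_zero_left this]; abel
  rw [pow_two, mul_assoc, h.hu, h.hu, hs]; noncomm_ring

lemma DRel.hEpow (h : DRel D u y z s) (a : ℕ) (X : R) :
    D ((u ^ 2) ^ a * X) = Kf (u ^ 2) ((u * y - y * u) + (u * z - z * u)) a * X
      + (u ^ 2) ^ a * D X := by
  induction a with
  | zero => simp [Kf]
  | succ a ih =>
    rw [pow_succ' (u ^ 2) a, mul_assoc, h.hE, ih, Kf]; noncomm_ring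

lemma DRel.hf (h : DRel D u y z s) (X : R) :
    D ((u * y - y * u) * X) = (y * z - z * y) * X - (u * y - y * u) * D X := by
  have hs : s = -y - z := by have := h.hs; rw [add_assoc] at this; rw [eq_neg_of_add_eq_zero_left this]; abel
  rw [sub_mul, map_sub, mul_assoc, mul_assoc, h.hu, h.hy, h.hy, h.hu, hs]; noncomm_ring

lemma DRel.main (h : DRel D u y z s) (a b : ℕ) :
    D ((u ^ 2) ^ a * (u * y - y * u) * (u ^ 2) ^ b) =
      Pf (u ^ 2) (u * y - y * u) a b
      - Nf (u ^ 2) (u * y - y * u) (u * z - z * u) (y * z - z * y) a b := by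
  rw [mul_assoc, h.hEpow, h.hf]
  have := h.hEpow b 1
  rw [h.h1, mul_one, mul_one, mul_zero, add_zero] at this
  rw [this, Kf_add, Kf_add, Pf, Nf]
  noncomm_ring

lemma DRel.main2 (h : DRel D u y z s) (a : ℕ) :
    D ((u ^ 2) ^ a * u) =
      Kf (u ^ 2) (u * y - y * u) a * u + Kf (u ^ 2) (u * z - z * u) a * u + (u ^ 2) ^ a * s := by
  rw [h.hEpow]
  have := h.hu 1
  rw [h.h1, mul_one, mul_one, mul_zero, sub_zero] at this
  rw [this, Kf_add]; noncomm_ring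

end Dpart

end SerreLie


namespace SerreLie
open TensorProduct

set_option linter.unusedSimpArgs false
set_option linter.unusedSectionVars false

variable {F : Type*} [CommRing F]

variable (F) in
abbrev Lam (m : ℕ) := ExteriorAlgebra F (Fin m → F)

variable (F) in
noncomputable def xi {m : ℕ} (i : Fin m) : Lam F m := ExteriorAlgebra.ι F (Pi.single i 1)

lemma xi_sq {m : ℕ} (i : Fin m) : xi F i * xi F i = 0 := ExteriorAlgebra.ι_sq_zero _

lemma xi_swap {m : ℕ} (i j : Fin m) : xi F i * xi F j = - (xi F j * xi F i) :=
  eq_neg_of_add_eq_zero_left (ExteriorAlgebra.ι_add_mul_swap _ _)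

lemma xi_list {m : ℕ} (l : List (Fin m)) : (l.map (xi F)).prod =
    ExteriorAlgebra.ιMulti F l.length (fun k => Pi.single (l.get k) (1 : F)) := by
  rw [ExteriorAlgebra.ιMulti_apply]
  congr 1
  conv_lhs => rw [← List.ofFn_get l]
  rw [List.map_ofFn]; rfl

lemma xi_list_zero {m : ℕ} {l : List (Fin m)} (h : ¬ l.Nodup) : (l.map (xi F)).prod = 0 := by
  rw [xi_list]
  apply AlternatingMap.map_eq_zero_of_not_injective
  intro hi
  apply h
  rw [List.nodup_iff_injective_get]
  intro a b hab
  apply hi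
  simp only [hab]

variable (F) in
noncomputable def topF (m : ℕ) : Lam F m →ₗ[F] F :=
  ExteriorAlgebra.liftAlternating (fun k =>
    if h : k = m then
      (Matrix.detRowAlternating (n := Fin m) (R := F)).domDomCongr (finCongr h.symm) else 0)

lemma topF_ιMulti {m : ℕ} (v : Fin m → (Fin m → F)) :
    topF F m (ExteriorAlgebra.ιMulti F m v) = Matrix.det (Matrix.of v) := by
  rw [topF, ExteriorAlgebra.liftAlternating_apply_ιMulti]
  simp
  rfl

lemma topF_perm {m : ℕ} (σ : Equiv.Perm (Fin m)) :
    topF F m (List.ofFn fun k => xi F (σ k)).prod = Equiv.Perm.sign σ := by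
  have : (List.ofFn fun k => xi F (σ k)).prod =
    ExteriorAlgebra.ιMulti F m (fun k => Pi.single (σ k) (1 : F)) := by
    rw [ExteriorAlgebra.ιMulti_apply]; rfl
  rw [this]
  have := (ExteriorAlgebra.ιMulti F m).map_perm (fun k => Pi.single k (1 : F)) σ
  rw [Function.comp_def] at this
  rw [this, LinearMap.map_smul_of_tower, topF_ιMulti]
  have : (Matrix.of fun k : Fin m => (Pi.single k (1 : F) : Fin m → F)) = 1 := by
    ext i j
    simp [Matrix.one_apply, Pi.single_apply, eq_comm]
  rw [this, Matrix.det_one, Units.smul_def, zsmul_one]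

variable (F) in
abbrev LA (m : ℕ) (A : Type*) [AddCommGroup A] [Module F A] := Lam F m ⊗[F] A

section modpart
variable {m : ℕ} {A B : Type*} [AddCommGroup A] [Module F A] [AddCommGroup B] [Module F B]

noncomputable def TopA : LA F m A →ₗ[F] A :=
  (TensorProduct.lid F A).toLinearMap ∘ₗ (LinearMap.rTensor A (topF F m))

@[simp] lemma TopA_tmul (a : Lam F m) (c : A) : TopA (a ⊗ₜ[F] c) = topF F m a • c := by
  simp [TopA]

lemma TopA_lTensor (φ : A →ₗ[F] B) (X : LA F m A) :
    TopA (LinearMap.lTensor (Lam F m) φ X) = φ (TopA X) := by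
  induction X using TensorProduct.induction_on with
  | zero => simp
  | tmul a c => simp
  | add X Y hX hY => simp [hX, hY]

end modpart

section algpart
variable {m : ℕ} {A B : Type*} [Ring A] [Algebra F A] [Ring B] [Algebra F B]

variable (F) in
noncomputable def uE (v : Fin m → A) : LA F m A := ∑ i, xi F i ⊗ₜ[F] v i
variable (F) in
noncomputable def cE (c : A) : LA F m A := 1 ⊗ₜ[F] c

variable (F) in
noncomputable def DLam (m : ℕ) : Lam F m →ₗ[F] Lam F m :=
  CliffordAlgebra.contractLeft (Q := (0 : QuadraticForm F (Fin m → F))) (∑ i, LinearMap.proj i)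

lemma DLam_xi (i : Fin m) (X : Lam F m) : DLam F m (xi F i * X) = X - xi F i * DLam F m X := by
  have := CliffordAlgebra.contractLeft_ι_mul (Q := (0 : QuadraticForm F (Fin m → F)))
    (∑ i, LinearMap.proj i) (Pi.single i 1) X
  have h1 : (∑ j : Fin m, (LinearMap.proj j : (Fin m → F) →ₗ[F] F)) (Pi.single i 1) = 1 := by
    rw [LinearMap.sum_apply]; simp [Pi.single_apply]
  rw [h1, one_smul] at this
  exact this

lemma DLam_one : DLam F m 1 = 0 := CliffordAlgebra.contractLeft_one _ _

noncomputable def DA : LA F m A →ₗ[F] LA F m A := LinearMap.rTensor A (DLam F m)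

lemma DA_u (v : Fin m → A) (X : LA F m A) :
    DA (uE F v * X) = cE F (∑ i, v i) * X - uE F v * DA X := by
  induction X using TensorProduct.induction_on with
  | zero => simp
  | tmul a c =>
    simp only [uE, cE, DA, Finset.sum_mul, map_sum, Algebra.TensorProduct.tmul_mul_tmul,
      LinearMap.rTensor_tmul, DLam_xi, sub_tmul, Finset.sum_sub_distrib, one_mul, tmul_sum]
  | add X Y hX hY => rw [mul_add, map_add, hX, hY, mul_add, map_add, mul_add]; abel

lemma DA_c (y : A) (X : LA F m A) : DA (cE F y * X) = cE F y * DA X := by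
  induction X using TensorProduct.induction_on with
  | zero => simp
  | tmul a c => simp [cE, DA]
  | add X Y hX hY => rw [mul_add, map_add, hX, hY, map_add, mul_add]

lemma DA_one : DA (1 : LA F m A) = 0 := by
  rw [Algebra.TensorProduct.one_def, DA, LinearMap.rTensor_tmul, DLam_one, zero_tmul]

lemma cE_add (a b : A) : (cE F (a + b) : LA F m A) = cE F a + cE F b := tmul_add _ _ _
lemma cE_sub (a b : A) : (cE F (a - b) : LA F m A) = cE F a - cE F b := tmul_sub _ _ _
lemma cE_neg (a : A) : (cE F (-a) : LA F m A) = -cE F a := tmul_neg _ _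
lemma cE_zero : (cE F (0 : A) : LA F m A) = 0 := tmul_zero _ _
lemma cE_mul (a b : A) : (cE F (a * b) : LA F m A) = cE F a * cE F b := by simp [cE]

lemma DRelA (v : Fin m → A) (y z : A) (h : ∑ i, v i + y + z = 0) :
    DRel (DA (m := m) (A := A)).toAddMonoidHom (uE F v) (cE F y) (cE F z) (cE F (∑ i, v i)) where
  hu := DA_u v
  hy := DA_c y
  hz := DA_c z
  h1 := DA_one
  hs := by rw [← cE_add, ← cE_add, h, cE_zero]

noncomputable def sigA : LA F m A →ₐ[F] LA F m A :=
  Algebra.TensorProduct.map (CliffordAlgebra.involute (Q := (0 : QuadraticForm F (Fin m → F))))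
    (AlgHom.id F A)

lemma xi_mul (i : Fin m) (a : Lam F m) :
    xi F i * a = CliffordAlgebra.involute (Q := (0 : QuadraticForm F (Fin m → F))) a * xi F i := by
  induction a using ExteriorAlgebra.induction with
  | algebraMap r =>
    have : CliffordAlgebra.involute (Q := (0 : QuadraticForm F (Fin m → F)))
      (algebraMap F (Lam F m) r) = algebraMap F (Lam F m) r := AlgHom.commutes _ _
    rw [this]; exact (Algebra.commutes r _).symm
  | ι x =>
    have : CliffordAlgebra.involute (Q := (0 : QuadraticForm F (Fin m → F)))
      (ExteriorAlgebra.ι F x) = - (ExteriorAlgebra.ι F x) := CliffordAlgebra.involute_ι x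
    rw [this, neg_mul]
    exact eq_neg_of_add_eq_zero_left (ExteriorAlgebra.ι_add_mul_swap _ _)
  | mul a b ha hb => 
    rw [map_mul, ← mul_assoc, ha, mul_assoc, hb, mul_assoc]
  | add a b ha hb => rw [mul_add, map_add, add_mul, ha, hb]

lemma sigA_u (v : Fin m → A) : sigA (uE F v) = - uE F v := by
  have : ∀ i : Fin m, CliffordAlgebra.involute (Q := (0 : QuadraticForm F (Fin m → F))) (xi F i)
     = - xi F i := fun i => CliffordAlgebra.involute_ι _
  simp [sigA, uE, this, neg_tmul]

lemma sigA_c (y : A) : sigA (cE F y : LA F m A) = cE F y := by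
  simp [sigA, cE]

noncomputable def mapA (φ : A →ₐ[F] B) : LA F m A →ₐ[F] LA F m B :=
  Algebra.TensorProduct.map (AlgHom.id F _) φ

lemma mapA_u (φ : A →ₐ[F] B) (v : Fin m → A) : mapA φ (uE F v) = uE F (fun i => φ (v i)) := by
  simp [mapA, uE]

lemma mapA_c (φ : A →ₐ[F] B) (y : A) : mapA φ (cE F y : LA F m A) = cE F (φ y) := by
  simp [mapA, cE]

lemma TopA_mapA (φ : A →ₐ[F] B) (X : LA F m A) : TopA (mapA φ X) = φ (TopA X) := by
  induction X using TensorProduct.induction_on with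
  | zero => simp
  | tmul a c => simp [mapA]
  | add X Y hX hY => simp [hX, hY]

lemma TopA_mul_c (X : LA F m A) (y : A) : TopA (X * cE F y) = TopA X * y := by
  induction X using TensorProduct.induction_on with
  | zero => simp
  | tmul a c => simp [cE]
  | add X Y hX hY => simp [hX, hY, add_mul]

/-! ### the span framework -/

abbrev Lab (m : ℕ) := Fin m ⊕ Fin 2

instance lawfulLab (m : ℕ) : LawfulBEq (Lab m) where
  eq_of_beq := by
    rintro (a | a) (b | b) h
    · exact congrArg _ (eq_of_beq (α := Fin m) h)
    · exact absurd h (by change ¬ (false = true); decide)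
    · exact absurd h (by change ¬ (false = true); decide)
    · exact congrArg _ (eq_of_beq (α := Fin 2) h)
  rfl := by
    rintro (a | a)
    · exact beq_self_eq_true (α := Fin m) a
    · exact beq_self_eq_true (α := Fin 2) a

variable (F) in
noncomputable def xl {m : ℕ} : Lab m → Lam F m := Sum.elim (xi F) (fun _ => 1)

/-- number of labels of odd type, and the counts of `y` and `z`. -/
def HasType (l : List (Lab m)) (k a b : ℕ) : Prop :=
  l.countP (fun x => x.isLeft) = k ∧ l.count (Sum.inr 0) = a ∧ l.count (Sum.inr 1) = b

variable (F) in
def Hs {K : Type*} (lab : K → List (Lab m)) (val : K → A) (k a b : ℕ) : Submodule F (LA F m A) :=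
  Submodule.span F {X | ∃ l : List K, HasType (l.flatMap lab) k a b ∧
    X = ((l.flatMap lab).map (xl F)).prod ⊗ₜ[F] (l.map val).prod}

lemma Hs_one {K : Type*} (lab : K → List (Lab m)) (val : K → A) : 1 ∈ Hs F lab val 0 0 0 := by
  apply Submodule.subset_span
  exact ⟨[], by simp [HasType], by simp [Algebra.TensorProduct.one_def]⟩

lemma Hs_single {K : Type*} (lab : K → List (Lab m)) (val : K → A) (x : K) (k a b : ℕ)
    (h : HasType (lab x) k a b) : ((lab x).map (xl F)).prod ⊗ₜ[F] val x ∈ Hs F lab val k a b := by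
  apply Submodule.subset_span
  exact ⟨[x], by simpa using h, by simp⟩

lemma Hs_cast {K : Type*} {lab : K → List (Lab m)} {val : K → A} {k a b k' a' b' : ℕ}
    {X : LA F m A} (h1 : k = k') (h2 : a = a') (h3 : b = b') (hX : X ∈ Hs F lab val k a b) :
    X ∈ Hs F lab val k' a' b' := by subst h1 h2 h3; exact hX

lemma Hs_mul {K : Type*} {lab : K → List (Lab m)} {val : K → A} {k a b k' a' b' : ℕ}
    {X Y : LA F m A} (hX : X ∈ Hs F lab val k a b) (hY : Y ∈ Hs F lab val k' a' b') :
    X * Y ∈ Hs F lab val (k + k') (a + a') (b + b') := by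
  have : Hs F lab val k a b * Hs F lab val k' a' b' ≤ Hs F lab val (k + k') (a + a') (b + b') := by
    rw [Hs, Hs, Submodule.span_mul_span, Submodule.span_le]
    rintro _ ⟨_, ⟨l, ⟨h1, h2, h3⟩, rfl⟩, _, ⟨l', ⟨h1', h2', h3'⟩, rfl⟩, rfl⟩
    apply Submodule.subset_span
    refine ⟨l ++ l', ?_, ?_⟩
    · simp [HasType, List.countP_append, List.count_append, h1, h2, h3, h1', h2', h3']
    · simp [Algebra.TensorProduct.tmul_mul_tmul]
  exact this (Submodule.mul_mem_mul hX hY)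

lemma Hs_pow {K : Type*} {lab : K → List (Lab m)} {val : K → A} {k : ℕ}
    {X : LA F m A} (hX : X ∈ Hs F lab val k 0 0) (r : ℕ) :
    X ^ r ∈ Hs F lab val (r * k) 0 0 := by
  induction r with
  | zero => simpa using Hs_one lab val
  | succ r ih =>
    rw [pow_succ, add_mul, one_mul]
    exact Hs_cast (by omega) (by omega) (by omega) (Hs_mul ih hX)

lemma Hs_Kf {K : Type*} {lab : K → List (Lab m)} {val : K → A} {k a b : ℕ}
    {E t : LA F m A} (hE : E ∈ Hs F lab val 2 0 0) (ht : t ∈ Hs F lab val k a b) (r : ℕ) :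
    Kf E t (r + 1) ∈ Hs F lab val (r * 2 + k) a b := by
  induction r with
  | zero => simpa [Kf] using ht
  | succ r ih =>
    rw [Kf]
    refine add_mem ?_ ?_
    · exact Hs_cast (by omega) (by omega) (by omega) (Hs_mul hE ih)
    · exact Hs_cast (by omega) (by omega) (by omega) (Hs_mul ht (Hs_pow hE (r + 1)))

lemma xl_prod (l : List (Lab m)) :
    (l.map (xl F)).prod = ((l.filterMap Sum.getLeft?).map (xi F)).prod := by
  induction l with
  | nil => simp
  | cons x l ih =>
    rcases x with x | x
    · simp [xl, ih, List.filterMap_cons]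
      rw [← ih]; rfl
    · simp [xl, List.filterMap_cons]
      rw [← ih]; rfl

lemma nodup_of_xl {l : List (Lab m)} {k a b : ℕ} (h : HasType l k a b) (ha : a ≤ 1) (hb : b ≤ 1)
    (hx : (l.map (xl F)).prod ≠ 0) : l.Nodup := by
  rw [xl_prod] at hx
  have h1 : (l.filterMap Sum.getLeft?).Nodup := by
    by_contra hc; exact hx (xi_list_zero hc)
  rw [List.nodup_iff_count_le_one]
  rintro (x | x)
  · rw [List.nodup_iff_count_le_one] at h1
    have := h1 x
    rw [List.count_filterMap] at this
    refine le_trans (le_of_eq ?_) this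
    rw [List.count]
    apply List.countP_congr
    rintro (c | c) _ <;> simp
  · obtain ⟨_, h2, h3⟩ := h
    fin_cases x
    · exact h2.trans_le ha
    · exact h3.trans_le hb

lemma length_of_type {l : List (Lab m)} {k a b : ℕ} (h : HasType l k a b) :
    l.length = k + a + b := by
  obtain ⟨rfl, rfl, rfl⟩ := h
  induction l with
  | nil => simp
  | cons x l ih =>
    rcases x with x | x
    · simp [ih, List.countP_cons, List.count_cons]; omega
    · fin_cases x <;> simp [ih, List.countP_cons, List.count_cons] <;> omega

lemma Hs_zero {K : Type*} {lab : K → List (Lab m)} {val : K → A} {k a b : ℕ} (hk : m < k)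
    {X : LA F m A} (hX : X ∈ Hs F lab val k a b) : X = 0 := by
  have : Hs F lab val k a b ≤ ⊥ := by
    rw [Hs, Submodule.span_le]
    rintro _ ⟨l, h, rfl⟩
    have : ((l.flatMap lab).map (xl F)).prod = 0 := by
      rw [xl_prod]
      apply xi_list_zero
      intro hn
      have h1 := hn.length_le_card
      rw [Fintype.card_fin] at h1
      have h2 : ∀ l : List (Lab m), (l.filterMap Sum.getLeft?).length = l.countP (fun x => x.isLeft) := by
        intro l
        induction l with
        | nil => simp
        | cons x l ih => rcases x with x | x <;> simp [List.filterMap_cons, List.countP_cons, ih]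
      rw [h2, h.1] at h1
      omega
    rw [this]; simp
  simpa using this hX

lemma Hs_top {K : Type*} {lab : K → List (Lab m)} {val : K → A} {k a b : ℕ}
    (ha : a ≤ 1) (hb : b ≤ 1)
    {X : LA F m A} (hX : X ∈ Hs F lab val k a b) :
    TopA X ∈ Submodule.span F {t | ∃ l : List K, HasType (l.flatMap lab) k a b ∧
      (l.flatMap lab).Nodup ∧ t = (l.map val).prod} := by
  have : Hs F lab val k a b ≤ (Submodule.span F {t | ∃ l : List K, HasType (l.flatMap lab) k a b ∧
      (l.flatMap lab).Nodup ∧ t = (l.map val).prod}).comap TopA := by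
    rw [Hs, Submodule.span_le]
    rintro _ ⟨l, h, rfl⟩
    rw [SetLike.mem_coe, Submodule.mem_comap, TopA_tmul]
    by_cases h0 : ((l.flatMap lab).map (xl F)).prod = 0
    · rw [h0]; simp
    · apply Submodule.smul_mem
      apply Submodule.subset_span
      exact ⟨l, h, nodup_of_xl h ha hb h0, rfl⟩
  exact this hX

/-! words -/

lemma word_u {v : Fin m → A} {y z : A} :
    uE F v ∈ Hs F (fun i : Lab m => [i]) (Sum.elim v ![y, z]) 1 0 0 := by
  rw [uE]
  refine Submodule.sum_mem _ fun i _ => ?_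
  have := Hs_single (F := F) (fun i : Lab m => [i]) (Sum.elim v ![y, z]) (Sum.inl i) 1 0 0 (by simp [HasType])
  simpa [xl, cE] using this

lemma word_y {v : Fin m → A} {y z : A} :
    cE F y ∈ Hs F (fun i : Lab m => [i]) (Sum.elim v ![y, z]) 0 1 0 := by
  have := Hs_single (F := F) (fun i : Lab m => [i]) (Sum.elim v ![y, z]) (Sum.inr 0) 0 1 0 (by simp [HasType])
  simpa [xl, cE] using this

lemma word_z {v : Fin m → A} {y z : A} :
    cE F z ∈ Hs F (fun i : Lab m => [i]) (Sum.elim v ![y, z]) 0 0 1 := by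
  have := Hs_single (F := F) (fun i : Lab m => [i]) (Sum.elim v ![y, z]) (Sum.inr 1) 0 0 1 (by simp [HasType])
  simpa [xl, cE] using this

lemma u_sq (v : Fin m → A) : uE F v ^ 2 =
    ∑ i, ∑ j ∈ Finset.Ioi i, (xi F i * xi F j) ⊗ₜ[F] (v i * v j - v j * v i) := by
  have h1 : uE F v ^ 2 = ∑ i, ∑ j, (xi F i * xi F j) ⊗ₜ[F] (v i * v j) := by
    simp [pow_two, uE, Finset.sum_mul, Finset.mul_sum]
    rw [Finset.sum_comm]
  have h2 : ∀ i, ∑ j, (xi F i * xi F j) ⊗ₜ[F] (v i * v j) =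
      ∑ j ∈ Finset.Ioi i, (xi F i * xi F j) ⊗ₜ[F] (v i * v j)
      + ∑ j ∈ Finset.Iio i, (xi F i * xi F j) ⊗ₜ[F] (v i * v j) := by
    intro i
    rw [← Finset.sum_add_sum_compl (Finset.Ioi i)]
    congr 1
    have : (Finset.Ioi i)ᶜ = insert i (Finset.Iio i) := by
      ext j; simp [le_iff_eq_or_lt]
    rw [this, Finset.sum_insert (by simp), xi_sq, zero_tmul, zero_add]
  rw [h1]
  simp only [h2, Finset.sum_add_distrib, tmul_sub, Finset.sum_sub_distrib]
  rw [sub_eq_add_neg]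
  congr 1
  have : ∑ i : Fin m, ∑ j ∈ Finset.Iio i, (xi F i * xi F j) ⊗ₜ[F] (v i * v j)
      = ∑ j : Fin m, ∑ i ∈ Finset.Ioi j, (xi F i * xi F j) ⊗ₜ[F] (v i * v j) := by
    apply Finset.sum_comm'
    intro x y; simp
  rw [this, ← Finset.sum_neg_distrib]
  refine Finset.sum_congr rfl fun i _ => ?_
  rw [← Finset.sum_neg_distrib]
  refine Finset.sum_congr rfl fun j _ => ?_
  rw [xi_swap, neg_tmul]

def cval (x : Lab m → A) (q : Lab m × Lab m) : A := x q.1 * x q.2 - x q.2 * x q.1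
def clab (q : Lab m × Lab m) : List (Lab m) := [q.1, q.2]

lemma com_E {v : Fin m → A} {y z : A} :
    uE F v ^ 2 ∈ Hs F clab (cval (Sum.elim v ![y, z])) 2 0 0 := by
  rw [u_sq]
  refine Submodule.sum_mem _ fun i _ => Submodule.sum_mem _ fun j _ => ?_
  have := Hs_single (F := F) clab (cval (Sum.elim v ![y, z])) (Sum.inl i, Sum.inl j) 2 0 0
    (by simp [HasType, clab, List.countP_cons, List.count_cons])
  simpa [xl, clab, cval, cE] using this

lemma com_f {v : Fin m → A} {y z : A} :
    uE F v * cE F y - cE F y * uE F v ∈ Hs F clab (cval (Sum.elim v ![y, z])) 1 1 0 := by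
  have : uE F v * cE F y - cE F y * uE F v = ∑ i, xi F i ⊗ₜ[F] (v i * y - y * v i) := by
    simp [uE, cE, Finset.sum_mul, Finset.mul_sum, tmul_sub]
  rw [this]
  refine Submodule.sum_mem _ fun i _ => ?_
  have := Hs_single (F := F) clab (cval (Sum.elim v ![y, z])) (Sum.inl i, Sum.inr 0) 1 1 0
    (by simp [HasType, clab, List.countP_cons, List.count_cons])
  simpa [xl, clab, cval, cE] using this

lemma com_f' {v : Fin m → A} {y z : A} :
    uE F v * cE F z - cE F z * uE F v ∈ Hs F clab (cval (Sum.elim v ![y, z])) 1 0 1 := by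
  have : uE F v * cE F z - cE F z * uE F v = ∑ i, xi F i ⊗ₜ[F] (v i * z - z * v i) := by
    simp [uE, cE, Finset.sum_mul, Finset.mul_sum, tmul_sub]
  rw [this]
  refine Submodule.sum_mem _ fun i _ => ?_
  have := Hs_single (F := F) clab (cval (Sum.elim v ![y, z])) (Sum.inl i, Sum.inr 1) 1 0 1
    (by simp [HasType, clab, List.countP_cons, List.count_cons])
  simpa [xl, clab, cval, cE] using this

lemma com_g {v : Fin m → A} {y z : A} :
    cE F y * cE F z - cE F z * cE F y ∈ Hs F clab (cval (Sum.elim v ![y, z])) 0 1 1 := by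
  rw [← cE_mul, ← cE_mul, ← cE_sub]
  have := Hs_single (F := F) clab (cval (Sum.elim v ![y, z])) (Sum.inr 0, Sum.inr 1) 0 1 1
    (by simp [HasType, clab, List.countP_cons, List.count_cons])
  simpa [xl, clab, cval, cE] using this

variable (F) in
noncomputable def NA (p : ℕ) (v : Fin m → A) (y z : A) : LA F m A :=
  ∑ b ∈ Finset.range p, cb p b • Nf (uE F v ^ 2) (uE F v * cE F y - cE F y * uE F v)
    (uE F v * cE F z - cE F z * uE F v) (cE F y * cE F z - cE F z * cE F y) (p - 1 - b) b

lemma NA_mem_gen {K : Type*} {lab : K → List (Lab m)} {val : K → A} {E f f' g : LA F m A}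
    (hE : E ∈ Hs F lab val 2 0 0) (hf : f ∈ Hs F lab val 1 1 0) (hf' : f' ∈ Hs F lab val 1 0 1)
    (hg : g ∈ Hs F lab val 0 1 1) (a b : ℕ) (hab : 2 * (a + b) = m) :
    Nf E f f' g a b ∈ Hs F lab val m 1 1 := by
  rw [Nf]
  refine add_mem (sub_mem (neg_mem ?_) ?_) ?_
  · cases a with
    | zero => simp [Kf]
    | succ a =>
      exact Hs_cast (by omega) (by omega) (by omega) (Hs_mul (Hs_mul (Hs_Kf hE hf' a) hf) (Hs_pow hE b))
  · exact Hs_cast (by omega) (by omega) (by omega) (Hs_mul (Hs_mul (Hs_pow hE a) hg) (Hs_pow hE b))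
  · cases b with
    | zero => simp [Kf]
    | succ b =>
      exact Hs_cast (by omega) (by omega) (by omega) (Hs_mul (Hs_mul (Hs_pow hE a) hf) (Hs_Kf hE hf' b))

lemma NA_word (p : ℕ) (hm : 2 * (p - 1) = m) (v : Fin m → A) (y z : A) :
    NA F p v y z ∈ Hs F (fun i : Lab m => [i]) (Sum.elim v ![y, z]) m 1 1 := by
  refine Submodule.sum_mem _ fun b hb => zsmul_mem ?_ _
  refine NA_mem_gen ?_ (sub_mem ?_ ?_) (sub_mem ?_ ?_) (sub_mem ?_ ?_) _ _
    (by have := Finset.mem_range.1 hb; omega)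
  · exact Hs_cast (by omega) (by omega) (by omega) (Hs_pow word_u 2)
  · exact Hs_cast (by omega) (by omega) (by omega) (Hs_mul word_u word_y)
  · exact Hs_cast (by omega) (by omega) (by omega) (Hs_mul word_y word_u)
  · exact Hs_cast (by omega) (by omega) (by omega) (Hs_mul word_u word_z)
  · exact Hs_cast (by omega) (by omega) (by omega) (Hs_mul word_z word_u)
  · exact Hs_cast (by omega) (by omega) (by omega) (Hs_mul word_y word_z)
  · exact Hs_cast (by omega) (by omega) (by omega) (Hs_mul word_z word_y)

lemma NA_com (p : ℕ) (hm : 2 * (p - 1) = m) (v : Fin m → A) (y z : A) :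
    NA F p v y z ∈ Hs F clab (cval (Sum.elim v ![y, z])) m 1 1 := by
  refine Submodule.sum_mem _ fun b hb => zsmul_mem ?_ _
  exact NA_mem_gen com_E com_f com_f' com_g _ _
    (by have := Finset.mem_range.1 hb; omega)

lemma mapA_NA (p : ℕ) (φ : A →ₐ[F] B) (v : Fin m → A) (y z : A) :
    mapA φ (NA F p v y z) = NA F p (fun i => φ (v i)) (φ y) (φ z) := by
  have hK : ∀ (E t : LA F m A) a, mapA φ (Kf E t a) = Kf (mapA φ E) (mapA φ t) a := by
    intro E' t a
    induction a with
    | zero => simp [Kf]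
    | succ a ih => simp [Kf, ih]
  simp only [NA, map_sum, map_zsmul, Nf, map_add, map_sub, map_neg, map_mul, map_pow, hK, mapA_u,
    mapA_c]

/-- the key relation in an algebra where the sum is zero. -/
lemma P_eq_N (p : ℕ) (hm : 2 * (p - 1) = m) (v : Fin m → A) (y z : A)
    (h : ∑ i, v i + y + z = 0) :
    ∑ b ∈ Finset.range p, cb p b • Pf (uE F v ^ 2) (uE F v * cE F y - cE F y * uE F v) (p - 1 - b) b
      = NA F p v y z := by
  refine Finset.sum_congr rfl fun b hb => ?_
  have h1 := (DRelA (F := F) v y z h).main (p - 1 - b) b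
  have h2 : (uE F v ^ 2) ^ (p - 1 - b) * (uE F v * cE F y - cE F y * uE F v) * (uE F v ^ 2) ^ b = 0 := by
    refine Hs_zero (k := m + 1) (a := 1) (b := 0) (by omega)
      (lab := (fun i : Lab m => [i])) (val := (Sum.elim v ![y, z])) ?_
    have hE : uE F v ^ 2 ∈ Hs F (fun i : Lab m => [i]) (Sum.elim v ![y, z]) 2 0 0 := Hs_cast (by omega) (by omega) (by omega) (Hs_pow word_u 2)
    have := Finset.mem_range.1 hb
    have hf : uE F v * cE F y - cE F y * uE F v ∈
        Hs F (fun i : Lab m => [i]) (Sum.elim v ![y, z]) 1 1 0 :=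
      sub_mem (Hs_cast (by omega) (by omega) (by omega) (Hs_mul word_u word_y))
        (Hs_cast (by omega) (by omega) (by omega) (Hs_mul word_y word_u))
    exact Hs_cast (by omega) (by omega) (by omega)
      (Hs_mul (Hs_mul (Hs_pow hE (p - 1 - b)) hf) (Hs_pow hE b))
  rw [h2, map_zero] at h1
  rw [sub_eq_zero.1 h1.symm]

/-- the relation used for `p • α`. -/
lemma K_eq (p : ℕ) (hm : 2 * (p - 1) = m) (v : Fin m → A) (y z : A)
    (h : ∑ i, v i + y + z = 0) :
    Kf (uE F v ^ 2) (uE F v * cE F y - cE F y * uE F v) (p - 1) * uE F v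
      = (uE F v ^ 2) ^ (p - 1) * cE F y + ((uE F v ^ 2) ^ (p - 1) * cE F z -
        Kf (uE F v ^ 2) (uE F v * cE F z - cE F z * uE F v) (p - 1) * uE F v) := by
  have h1 := (DRelA (F := F) v y z h).main2 (p - 1)
  have h2 : (uE F v ^ 2) ^ (p - 1) * uE F v = 0 := by
    refine Hs_zero (k := m + 1) (a := 0) (b := 0) (by omega)
      (lab := (fun i : Lab m => [i])) (val := (Sum.elim v ![y, z])) ?_
    have hE : uE F v ^ 2 ∈ Hs F (fun i : Lab m => [i]) (Sum.elim v ![y, z]) 2 0 0 := Hs_cast (by omega) (by omega) (by omega) (Hs_pow word_u 2)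
    exact Hs_cast (by omega) (by omega) (by omega) (Hs_mul (Hs_pow hE (p - 1)) word_u)
  have h3 : (∑ i, v i) = -y - z := by
    rw [add_assoc] at h; rw [eq_neg_of_add_eq_zero_left h]; abel
  rw [h2, map_zero, h3, cE_sub, cE_neg, mul_sub, mul_neg] at h1
  rw [← sub_eq_zero, h1]; abel

lemma K_word (p : ℕ) (hp : 2 ≤ p) (hm : 2 * (p - 1) = m) (v : Fin m → A) (y z : A) :
    (uE F v ^ 2) ^ (p - 1) * cE F z - Kf (uE F v ^ 2) (uE F v * cE F z - cE F z * uE F v) (p - 1) * uE F v ∈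
      Hs F (fun i : Lab m => [i]) (Sum.elim v ![y, z]) m 0 1 := by
  have hE : uE F v ^ 2 ∈ Hs F (fun i : Lab m => [i]) (Sum.elim v ![y, z]) 2 0 0 := Hs_cast (by omega) (by omega) (by omega) (Hs_pow word_u 2)
  refine sub_mem ?_ ?_
  · exact Hs_cast (by omega) (by omega) (by omega) (Hs_mul (Hs_pow hE (p - 1)) word_z)
  · obtain ⟨q, hq⟩ : ∃ q, p - 1 = q + 1 := ⟨p - 2, by omega⟩
    rw [hq]
    have hf : uE F v * cE F z - cE F z * uE F v ∈ Hs F (fun i : Lab m => [i]) (Sum.elim v ![y, z]) 1 0 1 :=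
      sub_mem (Hs_cast (by omega) (by omega) (by omega) (Hs_mul word_u word_z)) (Hs_cast (by omega) (by omega) (by omega) (Hs_mul word_z word_u))
    exact Hs_cast (by omega) (by omega) (by omega) (Hs_mul (Hs_Kf hE hf q) word_u)

end algpart

end SerreLie


namespace SerreLie
open TensorProduct
set_option linter.unusedSimpArgs false
set_option linter.unusedSectionVars false

section ring3
variable {R : Type*} [Ring R]

/-- the graded iterated commutator -/
def Sq (u c : R) : ℕ → R
  | 0 => c
  | a + 1 => u * Sq u c a - (-1) ^ a * (Sq u c a * u)

lemma Sq_two (u c : R) (a : ℕ) : Sq u c (a + 2) = u ^ 2 * Sq u c a - Sq u c a * u ^ 2 := by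
  rw [Sq, Sq]
  rcases neg_one_pow_eq_or R a with h | h <;> simp only [pow_succ, h] <;> noncomm_ring

lemma Sq_step (u c : R) (a b : ℕ) : Sq u c (a + 1) * u ^ b =
    u * (Sq u c a * u ^ b) - ((-1 : ℤ) ^ a) • (Sq u c a * u ^ (b + 1)) := by
  rw [Sq, zsmul_eq_mul, pow_succ', sub_mul]
  push_cast
  simp only [mul_assoc]

lemma Sq_odd (u c : R) (k : ℕ) : Sq u c (2 * k + 1) = Ad (u ^ 2) (u * c - c * u) k := by
  induction k with
  | zero => simp [Sq, Ad]
  | succ k ih =>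
    rw [show 2 * (k + 1) + 1 = (2 * k + 1) + 2 by ring, Sq_two, ih, Ad]

lemma Kf_Ad (E f : R) (n : ℕ) : Kf E f n =
    ∑ k ∈ Finset.range n, n.choose (k + 1) • (Ad E f k * E ^ (n - 1 - k)) := by
  induction n with
  | zero => simp [Kf]
  | succ n ih =>
    rw [Kf, ih, Finset.mul_sum]
    have h : ∀ k ∈ Finset.range n, E * n.choose (k + 1) • (Ad E f k * E ^ (n - 1 - k))
        = n.choose (k + 1) • (Ad E f (k + 1) * E ^ (n - (k + 1)))
          + n.choose (k + 1) • (Ad E f k * E ^ (n - k)) := by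
      intro k hk
      have h1 : n - k = (n - 1 - k) + 1 := by have := Finset.mem_range.1 hk; omega
      have h2 : n - (k + 1) = n - 1 - k := by omega
      rw [h1, h2, mul_smul_comm, ← smul_add, pow_succ']
      congr 1
      simp only [Ad]; noncomm_ring
    rw [Finset.sum_congr rfl h, Finset.sum_add_distrib]
    have e : ∀ k, (n + 1).choose (k + 1) • (Ad E f k * E ^ (n + 1 - 1 - k))
        = n.choose k • (Ad E f k * E ^ (n - k)) + n.choose (k + 1) • (Ad E f k * E ^ (n - k)) := by
      intro k
      rw [Nat.choose_succ_succ n k, add_smul]; rfl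
    simp only [e, Finset.sum_add_distrib]
    rw [Finset.sum_range_succ' (fun k => n.choose k • (Ad E f k * E ^ (n - k)))]
    rw [Finset.sum_range_succ (fun k => n.choose (k + 1) • (Ad E f k * E ^ (n - k)))]
    simp [Ad]
    abel

end ring3

section lie3
attribute [local instance 100] LieRing.ofAssociativeRing
variable {F : Type*} [CommRing F] {m : ℕ} {L A : Type*} [LieRing L] [LieAlgebra F L] [Ring A]
  [Algebra F A]

variable (F) in
noncomputable def uL (v : Fin m → L) : LA F m (Module.End F L) :=
  uE F (fun i => (LieAlgebra.ad F L (v i) : Module.End F L))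

variable (F) in
noncomputable def yL (y : L) : LA F m (Module.End F L) :=
  cE F (LieAlgebra.ad F L y : Module.End F L)

noncomputable def kap (φ : L →ₗ[F] A) (y : L) : LA F m (Module.End F L) →ₗ[F] LA F m A :=
  LinearMap.lTensor (Lam F m) (φ ∘ₗ LinearMap.applyₗ y)

noncomputable def evy (y : L) : LA F m (Module.End F L) →ₗ[F] LA F m L :=
  LinearMap.lTensor (Lam F m) (LinearMap.applyₗ y)

noncomputable def Uop (v : Fin m → L) : LA F m L →ₗ[F] LA F m L :=
  ∑ i, TensorProduct.map (LinearMap.mulLeft F (xi F i)) (LieAlgebra.ad F L (v i) : Module.End F L)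

lemma evy_u (v : Fin m → L) (y : L) (X : LA F m (Module.End F L)) :
    evy y (uL F v * X) = Uop v (evy y X) := by
  induction X using TensorProduct.induction_on with
  | zero => simp
  | tmul a T =>
    simp [uL, uE, evy, Uop, Finset.sum_mul, LinearMap.sum_apply]
  | add X Y hX hY => rw [mul_add, map_add, hX, hY, map_add, map_add]

lemma kap_u (φ : L →ₗ[F] A) (hφ : ∀ a b, φ ⁅a, b⁆ = φ a * φ b - φ b * φ a)
    (v : Fin m → L) (y : L) (X : LA F m (Module.End F L)) :
    kap φ y (uL F v * X) = uE F (fun i => φ (v i)) * kap φ y X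
      - sigA (kap φ y X) * uE F (fun i => φ (v i)) := by
  induction X using TensorProduct.induction_on with
  | zero => simp
  | tmul a T =>
    simp only [uL, uE, kap, Finset.sum_mul, Finset.mul_sum, LinearMap.lTensor_tmul, sigA,
      Algebra.TensorProduct.map_tmul, Algebra.TensorProduct.tmul_mul_tmul, map_sum,
      LinearMap.comp_apply, LinearMap.applyₗ_apply_apply, Module.End.mul_apply,
      LieAlgebra.ad_apply, hφ, tmul_sub, Finset.sum_sub_distrib, AlgHom.coe_id, id]
    congr 1
    refine Finset.sum_congr rfl fun i _ => ?_
    rw [xi_mul]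
  | add X Y hX hY =>
    rw [mul_add, map_add, hX, hY, map_add, map_add, mul_add, add_mul]; abel

lemma kap_y (φ : L →ₗ[F] A) (hφ : ∀ a b, φ ⁅a, b⁆ = φ a * φ b - φ b * φ a)
    (y : L) (X : LA F m (Module.End F L)) :
    kap φ y (yL F y * X) = cE F (φ y) * kap φ y X - kap φ y X * cE F (φ y) := by
  induction X using TensorProduct.induction_on with
  | zero => simp
  | tmul a T =>
    simp [yL, cE, kap, hφ, tmul_sub]
  | add X Y hX hY =>
    rw [mul_add, map_add, hX, hY, map_add, mul_add, add_mul]; abel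

lemma sigA_Sq (v : Fin m → A) (y : A) (a : ℕ) :
    sigA (Sq (uE F v) (cE F y) a) = (-1) ^ a * Sq (uE F v) (cE F y) a := by
  induction a with
  | zero => simp [Sq, sigA_c]
  | succ a ih =>
    rw [Sq, map_sub, map_mul, map_mul, map_mul, map_pow, map_neg, map_one, sigA_u, ih]
    rcases neg_one_pow_eq_or (LA F m A) a with h | h <;> simp only [pow_succ, h] <;> noncomm_ring

lemma kap_pow (φ : L →ₗ[F] A) (hφ : ∀ a b, φ ⁅a, b⁆ = φ a * φ b - φ b * φ a)
    (v : Fin m → L) (y : L) (b : ℕ) :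
    kap φ y (uL F v ^ b) = Sq (uE F (fun i => φ (v i))) (cE F (φ y)) b := by
  induction b with
  | zero =>
    rw [pow_zero, Sq, Algebra.TensorProduct.one_def, kap, LinearMap.lTensor_tmul, cE]; simp
  | succ b ih =>
    rw [pow_succ', kap_u φ hφ, ih, sigA_Sq, Sq, mul_assoc]

lemma kap_Sq (φ : L →ₗ[F] A) (hφ : ∀ a b, φ ⁅a, b⁆ = φ a * φ b - φ b * φ a)
    (v : Fin m → L) (y : L) (a b : ℕ) :
    kap φ y (Sq (uL F v) (yL F y) a * uL F v ^ b) =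
      Sq (uE F (fun i => φ (v i))) (cE F (φ y)) a * Sq (uE F (fun i => φ (v i))) (cE F (φ y)) b
      - (-1) ^ (a * b) * (Sq (uE F (fun i => φ (v i))) (cE F (φ y)) b *
        Sq (uE F (fun i => φ (v i))) (cE F (φ y)) a) := by
  induction a generalizing b with
  | zero =>
    rw [Sq, kap_y φ hφ, kap_pow φ hφ, Sq]; simp
  | succ a ih =>
    have e := Sq_step (uL F v) (yL F y) a b
    have e' : (((-1 : ℤ) ^ a : ℤ) : LA F m A) = (-1) ^ a := by simp
    have hs1 : sigA ((-1 : LA F m A) ^ (a * b)) = (-1) ^ (a * b) := by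
      rw [map_pow, map_neg, map_one]
    rw [e, map_sub, map_zsmul, kap_u φ hφ, ih, ih, map_sub, map_mul, map_mul, map_mul, hs1, sigA_Sq,
      sigA_Sq, zsmul_eq_mul, e', Sq.eq_2 _ _ b, Sq.eq_2 _ _ a]
    generalize Sq (uE F fun i => φ (v i)) (cE F (φ y)) a = P
    generalize Sq (uE F fun i => φ (v i)) (cE F (φ y)) b = Q
    rw [show a * (b + 1) = a * b + a by ring, show (a + 1) * b = a * b + b by ring, pow_add, pow_add]
    rcases neg_one_pow_eq_or (LA F m A) a with h | h <;>
    rcases neg_one_pow_eq_or (LA F m A) b with h' | h' <;>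
    rcases neg_one_pow_eq_or (LA F m A) (a * b) with h'' | h'' <;>
    simp only [h, h', h''] <;> noncomm_ring

variable (F) in
noncomputable def bet (v : Fin m → L) (y : L) (a b : ℕ) : LA F m L :=
  evy y (Sq (uL F v) (yL F y) a * uL F v ^ b)

lemma bet_zero (v : Fin m → L) (y : L) (b : ℕ) : bet F v y 0 b = - bet F v y b 0 := by
  have h := kap_pow (F := F) (A := Module.End F L) (LieAlgebra.ad F L : L →ₗ[F] Module.End F L)
    (by intro a b; exact (LieAlgebra.ad F L).map_lie a b) v y b
  have h2 : Sq (uL F v) (yL F y) b = kap (LieAlgebra.ad F L : L →ₗ[F] Module.End F L) y (uL F v ^ b) := h.symm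
  rw [bet, bet, Sq, pow_zero, mul_one, h2]
  generalize uL F v ^ b = X
  induction X using TensorProduct.induction_on with
  | zero => simp
  | tmul a T =>
    simp only [yL, cE, evy, kap, Algebra.TensorProduct.tmul_mul_tmul, LinearMap.lTensor_tmul,
      one_mul, LinearMap.applyₗ_apply_apply, Module.End.mul_apply, LinearMap.comp_apply,
      LieHom.coe_toLinearMap, LieAlgebra.ad_apply, ← tmul_neg, lie_skew]
  | add X Y hX hY =>
    rw [mul_add, map_add, hX, hY, map_add, map_add]; abel

lemma bet_succ (v : Fin m → L) (y : L) (a b : ℕ) :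
    bet F v y (a + 1) b = Uop v (bet F v y a b) - ((-1 : ℤ) ^ a) • bet F v y a (b + 1) := by
  rw [bet, bet, bet, ← evy_u, ← map_zsmul, ← map_sub]
  congr 1
  exact Sq_step _ _ _ _

lemma bet_symm (v : Fin m → L) (y : L) (a b : ℕ) :
    bet F v y a b = - (((-1 : ℤ) ^ (a * b)) • bet F v y b a) := by
  induction a generalizing b with
  | zero => simp [bet_zero v y b]
  | succ a ih =>
    rw [bet_succ, ih b, ih (b + 1), bet_succ v y b a, map_neg, map_zsmul]
    rw [show a * (b + 1) = a * b + a by ring, show (a + 1) * b = a * b + b by ring, pow_add, pow_add]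
    rcases neg_one_pow_eq_or ℤ a with h | h <;>
    rcases neg_one_pow_eq_or ℤ b with h' | h' <;>
    rcases neg_one_pow_eq_or ℤ (a * b) with h'' | h'' <;>
    simp only [h, h', h''] <;> simp <;> abel

end lie3
end SerreLie


namespace SerreLie
open TensorProduct
set_option linter.unusedSimpArgs false
set_option linter.unusedSectionVars false

lemma sum_fold {M : Type*} [AddCommMonoid M] (q : ℕ) (g : ℕ → M) :
    ∑ k ∈ Finset.range (2 * q), g k = ∑ k ∈ Finset.range q, (g k + g (2 * q - 1 - k)) := by
  rw [two_mul, Finset.sum_range_add, Finset.sum_add_distrib]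
  congr 1
  rw [← Finset.sum_range_reflect]
  refine Finset.sum_congr rfl fun k hk => ?_
  congr 1
  have := Finset.mem_range.1 hk
  omega

section lie4
variable {F : Type*} [CommRing F] {m : ℕ} {L A : Type*} [LieRing L] [LieAlgebra F L] [Ring A]
  [Algebra F A]

lemma TopA_evy (y : L) (X : LA F m (Module.End F L)) : TopA (evy y X) = (TopA X) y := by
  rw [evy, TopA_lTensor]; rfl

lemma TopA_kap (φ : L →ₗ[F] A) (y : L) (X : LA F m (Module.End F L)) :
    TopA (kap φ y X) = φ (TopA (evy y X)) := by
  rw [kap, TopA_lTensor, TopA_evy]; rfl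

variable (F) in
noncomputable def BB (v : Fin m → L) (y : L) (p k : ℕ) : L :=
  TopA (bet F v y (2 * k + 1) (2 * (p - 2 - k) + 1))

lemma BB_symm (v : Fin m → L) (y : L) (p k : ℕ) (hk : k + 1 < p) :
    BB F v y p (p - 2 - k) = BB F v y p k := by
  rw [BB, BB, bet_symm]
  rw [show p - 2 - (p - 2 - k) = k by omega]
  rw [Odd.neg_one_pow (by
    apply Odd.mul <;> exact ⟨_, rfl⟩)]
  simp

lemma TopK (v : Fin m → L) (y : L) (p : ℕ) (hp : 2 ≤ p) :
    (TopA (Kf (uL F v ^ 2) (uL F v * yL F y - yL F y * uL F v) (p - 1) * uL F v)) y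
      = ∑ k ∈ Finset.range (p - 1), (p - 1).choose (k + 1) • BB F v y p k := by
  rw [← TopA_evy, Kf_Ad, Finset.sum_mul, map_sum, map_sum]
  refine Finset.sum_congr rfl fun k hk => ?_
  rw [smul_mul_assoc, map_nsmul, map_nsmul, BB, bet, Sq_odd, mul_assoc, ← pow_mul, ← pow_succ]
  rw [show p - 1 - 1 - k = p - 2 - k by omega]

lemma phi_BB (φ : L →ₗ[F] A) (hφ : ∀ a b, φ ⁅a, b⁆ = φ a * φ b - φ b * φ a)
    (v : Fin m → L) (y : L) (p k : ℕ) :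
    φ (BB F v y p k) = TopA (
      Ad (uE F (fun i => φ (v i)) ^ 2) (uE F (fun i => φ (v i)) * cE F (φ y)
        - cE F (φ y) * uE F (fun i => φ (v i))) k *
      Ad (uE F (fun i => φ (v i)) ^ 2) (uE F (fun i => φ (v i)) * cE F (φ y)
        - cE F (φ y) * uE F (fun i => φ (v i))) (p - 2 - k) +
      Ad (uE F (fun i => φ (v i)) ^ 2) (uE F (fun i => φ (v i)) * cE F (φ y)
        - cE F (φ y) * uE F (fun i => φ (v i))) (p - 2 - k) *
      Ad (uE F (fun i => φ (v i)) ^ 2) (uE F (fun i => φ (v i)) * cE F (φ y)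
        - cE F (φ y) * uE F (fun i => φ (v i))) k) := by
  rw [BB, bet, ← TopA_kap, kap_Sq φ hφ, Sq_odd, Sq_odd, Odd.neg_one_pow (by
    apply Odd.mul <;> exact ⟨_, rfl⟩)]
  congr 1
  noncomm_ring

lemma qk_symm {p k : ℕ} (hp : p.Prime) (hk : k + 1 < p) : qk p (p - 2 - k) = qk p k := by
  have h1 := qk_spec hp hk
  have h2 := qk_spec hp (k := p - 2 - k) (by omega)
  rw [← Nat.choose_symm (by omega), show p - (p - 2 - k + 1) = k + 1 by omega, ← h1] at h2
  exact Nat.eq_of_mul_eq_mul_left hp.pos h2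

lemma alpha_exists (p : ℕ) (hp : p.Prime) (hm : 2 * (p - 1) = m) (φ : L →ₗ[F] A)
    (hφ : ∀ a b, φ ⁅a, b⁆ = φ a * φ b - φ b * φ a) (v : Fin m → L) (y : L) :
    ∃ α : L, p • α =
      (TopA (Kf (uL F v ^ 2) (uL F v * yL F y - yL F y * uL F v) (p - 1) * uL F v)) y ∧
     φ α = TopA (∑ k ∈ Finset.range (p - 1), qk p k • (
      Ad (uE F (fun i => φ (v i)) ^ 2) (uE F (fun i => φ (v i)) * cE F (φ y)
        - cE F (φ y) * uE F (fun i => φ (v i))) k *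
      Ad (uE F (fun i => φ (v i)) ^ 2) (uE F (fun i => φ (v i)) * cE F (φ y)
        - cE F (φ y) * uE F (fun i => φ (v i))) (p - 2 - k))) := by
  rcases hp.eq_two_or_odd' with rfl | ⟨q, hq⟩
  · obtain rfl : m = 2 := by omega
    have t01 : topF F 2 (xi F 0 * xi F 1) = 1 := by
      have := topF_perm (F := F) (1 : Equiv.Perm (Fin 2))
      simpa [List.ofFn_succ] using this
    have t10 : topF F 2 (xi F 1 * xi F 0) = -1 := by
      rw [xi_swap, map_neg, t01]
    have q0 : qk 2 0 = 1 := by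
      have := qk_spec Nat.prime_two (k := 0) (by omega)
      simp at this; omega
    refine ⟨⁅⁅v 0, y⁆, ⁅v 1, y⁆⁆, ?_, ?_⟩
    · simp only [Nat.add_one_sub_one, Kf, mul_zero, pow_zero, mul_one, zero_add]
      have : (uL F v * yL F y - yL F y * uL F v) * uL F v =
          ∑ i, ∑ j, (xi F i * xi F j) ⊗ₜ[F] ((LieAlgebra.ad F L (v i) * LieAlgebra.ad F L y -
            LieAlgebra.ad F L y * LieAlgebra.ad F L (v i)) * LieAlgebra.ad F L (v j) :
              Module.End F L) := by
        simp [uL, yL, uE, cE, Fin.sum_univ_two, mul_add, add_mul, sub_mul, tmul_sub, mul_assoc]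
        abel
      rw [this]
      simp [Fin.sum_univ_two, xi_sq, t01, t10, two_smul]
      have h1 : ∀ a b : L, ⁅a, ⁅y, ⁅b, y⁆⁆⁆ - ⁅y, ⁅a, ⁅b, y⁆⁆⁆ = ⁅⁅a, y⁆, ⁅b, y⁆⁆ := by
        intro a b; rw [lie_lie]
      rw [h1, ← neg_sub, h1]
      rw [← lie_skew ⁅v 1, y⁆]; abel
    · simp only [Nat.add_one_sub_one, Finset.sum_range_one, show 2 - 2 - 0 = 0 from rfl, Ad, q0, one_smul]
      have : (uE F (fun i => φ (v i)) * cE F (φ y) - cE F (φ y) * uE F (fun i => φ (v i)))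
        = ∑ i, xi F i ⊗ₜ[F] φ ⁅v i, y⁆ := by
        simp [uE, cE, Fin.sum_univ_two, mul_add, add_mul, sub_mul, tmul_sub, mul_assoc, hφ]
      rw [this, hφ]
      simp [Fin.sum_univ_two, xi_sq, t01, t10, mul_add, add_mul]
      abel
  · have hp2 := hp.two_le
    refine ⟨∑ k ∈ Finset.range q, qk p k • BB F v y p k, ?_, ?_⟩
    · rw [TopK v y p hp2, show p - 1 = 2 * q by omega, sum_fold, Finset.smul_sum]
      refine Finset.sum_congr rfl fun k hk => ?_
      have hk' := Finset.mem_range.1 hk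
      rw [show 2 * q - 1 - k = p - 2 - k by omega, BB_symm v y p k (by omega), ← add_smul, smul_smul,
        qk_spec hp (by omega)]
      congr 1
      rw [show p - 2 - k + 1 = 2 * q - k by omega, Nat.choose_symm (by omega), hq,
        Nat.choose_succ_succ', add_comm]
    · rw [show p - 1 = 2 * q by omega, sum_fold, map_sum, map_sum]
      refine Finset.sum_congr rfl fun k hk => ?_
      have hk' := Finset.mem_range.1 hk
      rw [show 2 * q - 1 - k = p - 2 - k by omega, qk_symm hp (by omega), ← smul_add, map_nsmul,
        map_nsmul, phi_BB φ hφ, show p - 2 - (p - 2 - k) = k by omega]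

end lie4
end SerreLie


namespace SerreLie
open TensorProduct
set_option linter.unusedSimpArgs false
set_option linter.unusedSectionVars false

lemma sqz_pow {R : Type*} [Ring R] {a b : R} (h : Commute a b) (ha : a * a = 0) (n : ℕ) :
    (b + a) ^ (n + 1) = b ^ (n + 1) + (n + 1) • (b ^ n * a) := by
  induction n with
  | zero => simp
  | succ n ih =>
    rw [pow_succ, ih, add_mul, mul_add, mul_add, smul_mul_assoc, smul_mul_assoc, mul_assoc,
      mul_assoc, ha, mul_zero, smul_zero, add_zero, h.eq, ← mul_assoc, ← pow_succ, ← pow_succ,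
      add_assoc, succ_nsmul' _ (n + 1)]

lemma sq_sum_pow {R : Type*} [Ring R] (a : ℕ → R) (hc : ∀ i j, Commute (a i) (a j))
    (h0 : ∀ i, a i * a i = 0) (r : ℕ) :
    (∑ k ∈ Finset.range r, a k) ^ r = r.factorial • ((List.range r).map a).prod ∧
    (∑ k ∈ Finset.range r, a k) ^ (r + 1) = 0 := by
  induction r with
  | zero => simp
  | succ r ih =>
    have hc' : Commute (a r) (∑ k ∈ Finset.range r, a k) := Commute.sum_right _ _ _ fun i _ => hc _ _
    rw [Finset.sum_range_succ]
    constructor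
    · rw [sqz_pow hc' (h0 r), ih.1, ih.2, zero_add, List.range_succ, List.map_append, List.prod_append,
        smul_mul_assoc, smul_smul, Nat.factorial_succ]
      simp
    · rw [sqz_pow hc' (h0 r), pow_succ, ih.2]; simp

section wpart
variable {F : Type*} [CommRing F]

variable (F) in
noncomputable def xiN (m i : ℕ) : Lam F m := if h : i < m then xi F ⟨i, h⟩ else 0

lemma xiN_sq (m i : ℕ) : xiN F m i * xiN F m i = 0 := by
  unfold xiN; split_ifs <;> simp [xi_sq]

lemma xiN_swap (m i j : ℕ) : xiN F m i * xiN F m j = - (xiN F m j * xiN F m i) := by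
  unfold xiN; split_ifs
  · exact xi_swap _ _
  all_goals simp

variable (F) in
noncomputable def omg (m : ℕ) (q : ℕ) : Lam F m :=
  ∑ k ∈ Finset.range q, xiN F m (2 * k) * xiN F m (2 * k + 1)

lemma top_omg (q : ℕ) : topF F (2 * q) (omg F (2 * q) q ^ q) = (q.factorial : F) := by
  have hc : ∀ m i j, Commute (xiN F m (2 * i) * xiN F m (2 * i + 1))
      (xiN F m (2 * j) * xiN F m (2 * j + 1)) := by
    intro m i j
    have e : ∀ a b c : ℕ, (xiN F m a * xiN F m b) * xiN F m c
        = xiN F m c * (xiN F m a * xiN F m b) := by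
      intro a b c
      rw [mul_assoc, xiN_swap m b c, mul_neg, ← mul_assoc, xiN_swap m a c, neg_mul, neg_neg, mul_assoc]
    rw [Commute, SemiconjBy, ← mul_assoc, e, mul_assoc, e, mul_assoc]
  have h0 : ∀ m i, (xiN F m (2 * i) * xiN F m (2 * i + 1)) *
      (xiN F m (2 * i) * xiN F m (2 * i + 1)) = 0 := by
    intro m i
    rw [mul_assoc, ← mul_assoc (xiN F m (2 * i + 1)), xiN_swap m (2 * i + 1) (2 * i), neg_mul,
      mul_neg, mul_assoc, xiN_sq]
    simp
  have h1 := (sq_sum_pow (fun k => xiN F (2 * q) (2 * k) * xiN F (2 * q) (2 * k + 1))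
    (hc _) (h0 _) q).1
  rw [omg, h1, map_nsmul]
  have h2 : ∀ (m r : ℕ), ((List.range r).map (fun k => xiN F m (2 * k) * xiN F m (2 * k + 1))).prod
      = ((List.range (2 * r)).map (xiN F m)).prod := by
    intro m r
    induction r with
    | zero => simp
    | succ r ih =>
      rw [mul_add, mul_one, List.range_succ, List.range_succ, List.range_succ]
      simp [ih, mul_assoc]
  rw [h2]
  have h3 : ((List.range (2 * q)).map (xiN F (2 * q))).prod
      = (List.ofFn fun k => xi F ((1 : Equiv.Perm (Fin (2 * q))) k)).prod := by
    rw [List.ofFn_eq_map, ← List.map_coe_finRange_eq_range, List.map_map]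
    congr 1
    apply List.map_congr_left
    intro k _
    simp [xiN]
  rw [h3, topF_perm]
  simp

variable {W : Type*} [Ring W] [Algebra F W]

lemma u_sq_omg (q : ℕ) (w : ℕ → W)
    (hw : ∀ i j, i < j → w i * w j - w j * w i = if i % 2 = 0 ∧ j = i + 1 then 1 else 0) :
    uE F (fun i : Fin (2 * q) => w i) ^ 2 = omg F (2 * q) q ⊗ₜ[F] 1 := by
  rw [u_sq]
  have h1 : ∀ i : Fin (2 * q), ∑ j ∈ Finset.Ioi i,
      (xi F i * xi F j) ⊗ₜ[F] (w i * w j - w j * w i) =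
      (fun i : ℕ => if i % 2 = 0 then (xiN F (2 * q) i * xiN F (2 * q) (i + 1)) ⊗ₜ[F] (1 : W) else 0) i := by
    intro i
    have h2 : ∀ j ∈ Finset.Ioi i, (xi F i * xi F j) ⊗ₜ[F] (w i * w j - w j * w i) =
        if (i : ℕ) % 2 = 0 ∧ (j : ℕ) = i + 1 then (xi F i * xi F j) ⊗ₜ[F] 1 else 0 := by
      intro j hj
      have hlt : i < j := Finset.mem_Ioi.1 hj
      rw [hw i j (Fin.lt_def.1 hlt)]
      split_ifs <;> simp
    rw [Finset.sum_congr rfl h2]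
    by_cases hi : (i : ℕ) % 2 = 0
    · have hlt : (i : ℕ) + 1 < 2 * q := by have := i.2; omega
      rw [Finset.sum_eq_single ⟨(i : ℕ) + 1, hlt⟩]
      · simp [hi, xiN, hlt]
      · intro j _ hj
        rw [if_neg]
        rintro ⟨_, h⟩
        exact hj (Fin.ext h)
      · intro h
        exfalso; apply h
        rw [Finset.mem_Ioi, Fin.lt_def]
        simp
    · simp [hi]
  rw [Finset.sum_congr rfl fun i _ => h1 i]
  refine (Fin.sum_univ_eq_sum_range (fun i : ℕ => if i % 2 = 0 then (xiN F (2 * q) i * xiN F (2 * q) (i + 1)) ⊗ₜ[F] (1 : W) else 0) (2 * q)).trans ?_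
  rw [omg, sum_tmul]
  have h3 : ∀ (r : ℕ) (h : ℕ → LA F (2 * q) W), ∑ i ∈ Finset.range (2 * r), h i
      = ∑ k ∈ Finset.range r, (h (2 * k) + h (2 * k + 1)) := by
    intro r h
    induction r with
    | zero => simp
    | succ r ih =>
      rw [mul_add, mul_one, Finset.sum_range_succ, Finset.sum_range_succ, ih,
        Finset.sum_range_succ _ r, add_assoc]
  rw [h3]
  refine Finset.sum_congr rfl fun k _ => ?_
  rw [if_pos (by omega), if_neg (by omega), add_zero]

lemma tmul_one_pow {m : ℕ} (a : Lam F m) (r : ℕ) :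
    (a ⊗ₜ[F] (1 : W)) ^ r = (a ^ r) ⊗ₜ[F] 1 := by
  rw [Algebra.TensorProduct.tmul_pow, one_pow]

lemma NA_W (p : ℕ) (hp : p.Prime) (w : ℕ → W)
    (hw : ∀ i j, i < j → w i * w j - w j * w i = if i % 2 = 0 ∧ j = i + 1 then 1 else 0) :
    TopA (NA F p (fun i : Fin (2 * (p - 1)) => w i) (w (2 * p - 2)) (w (2 * p - 1)))
      = ((p - 1).factorial : F) • (1 : W) := by
  have hp2 := hp.two_le
  have hf : ∀ j, 2 * (p - 1) ≤ j → uE F (fun i : Fin (2 * (p - 1)) => w i) * cE F (w j) -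
      cE F (w j) * uE F (fun i : Fin (2 * (p - 1)) => w i) = 0 := by
    intro j hj
    have : uE F (fun i : Fin (2 * (p - 1)) => w i) * cE F (w j) -
      cE F (w j) * uE F (fun i : Fin (2 * (p - 1)) => w i)
      = ∑ i : Fin (2 * (p - 1)), xi F i ⊗ₜ[F] (w i * w j - w j * w i) := by
      simp [uE, cE, Finset.sum_mul, Finset.mul_sum, tmul_sub]
    rw [this]
    apply Finset.sum_eq_zero
    intro i _
    have := i.2
    rw [hw i j (by omega), if_neg (by omega), tmul_zero]
  rw [NA, hf _ (by omega), hf _ (by omega), ← cE_mul, ← cE_mul, ← cE_sub, hw _ _ (by omega),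
    if_pos ⟨by omega, by omega⟩, u_sq_omg _ _ hw]
  have : ∀ b ∈ Finset.range p, cb p b • Nf (omg F (2 * (p - 1)) (p - 1) ⊗ₜ[F] (1 : W)) 0 0 (cE F 1)
      (p - 1 - b) b = cb p b • (-((omg F (2 * (p - 1)) (p - 1) ⊗ₜ[F] (1 : W))^ (p - 1))) := by
    intro b hb
    have := Finset.mem_range.1 hb
    rw [Nf]
    have e : (cE F 1 : LA F (2 * (p - 1)) W) = 1 := rfl
    rw [e, mul_zero, zero_mul, neg_zero, mul_zero, zero_mul, add_zero, mul_one, ← pow_add, zero_sub,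
      show p - 1 - b + b = p - 1 by omega]
  rw [Finset.sum_congr rfl this, ← Finset.sum_smul, sum_cb hp, neg_smul, one_smul, neg_neg,
    tmul_one_pow, TopA_tmul, top_omg]

lemma u_pow_expand {m : ℕ} (w : Fin m → W) (r : ℕ) : uE F w ^ r =
    ∑ g : Fin r → Fin m, (List.ofFn fun k => xi F (g k)).prod ⊗ₜ[F] (List.ofFn fun k => w (g k)).prod := by
  induction r with
  | zero => simp [Algebra.TensorProduct.one_def]
  | succ r ih =>
    rw [pow_succ', ih, uE, ← (Fin.consEquiv (fun _ : Fin (r + 1) => Fin m)).sum_comp,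
      Fintype.sum_prod_type, Finset.sum_mul]
    refine Finset.sum_congr rfl fun i _ => ?_
    rw [Finset.mul_sum]
    refine Finset.sum_congr rfl fun g _ => ?_
    simp [List.ofFn_succ, Fin.consEquiv]

lemma top_u_pow {n : ℕ} (w : Fin n → W) : TopA (uE F w ^ n) =
    ∑ ρ : Equiv.Perm (Fin n), ((Equiv.Perm.sign ρ : ℤ) : F) • (List.ofFn fun k => w (ρ k)).prod := by
  rw [u_pow_expand, map_sum]
  simp only [TopA_tmul]
  symm
  refine Finset.sum_of_injOn (fun ρ : Equiv.Perm (Fin n) => (ρ : Fin n → Fin n)) ?_ ?_ ?_ ?_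
  · intro a _ b _ h
    exact DFunLike.coe_injective h
  · intro _ _; simp
  · intro g _ hg
    have : (List.ofFn fun k => xi F (g k)).prod = 0 := by
      have h := xi_list_zero (F := F) (l := List.ofFn g) (by
        rw [List.nodup_ofFn]
        intro hi
        apply hg
        exact ⟨Equiv.ofBijective g (Finite.injective_iff_bijective.1 hi), by simp, by ext; simp⟩)
      rwa [List.map_ofFn] at h
    rw [this]; simp
  · intro ρ _
    rw [topF_perm]

lemma sum_sign_W (p : ℕ) (w : ℕ → W)
    (hw : ∀ i j, i < j → w i * w j - w j * w i = if i % 2 = 0 ∧ j = i + 1 then 1 else 0) :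
    ∑ ρ : Equiv.Perm (Fin (2 * p)), ((Equiv.Perm.sign ρ : ℤ) : F) •
      (List.ofFn fun k => w (ρ k)).prod = (p.factorial : F) • (1 : W) := by
  rw [← top_u_pow (fun i : Fin (2 * p) => w i), pow_mul, u_sq_omg p w hw, tmul_one_pow, TopA_tmul,
    top_omg]

/-! the concrete operators -/

variable (F) in
abbrev WW := Module.End F (MvPolynomial ℕ F)

variable (F) in
noncomputable def wW (i : ℕ) : WW F :=
  if i % 2 = 0 then (MvPolynomial.pderiv (R := F) (i / 2)).toLinearMap
  else LinearMap.mulLeft F (MvPolynomial.X (i / 2))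

lemma wW_comm (i j : ℕ) : wW F i * wW F j - wW F j * wW F i =
    if i % 2 = 0 ∧ j = i + 1 then 1 else if j % 2 = 0 ∧ i = j + 1 then -1 else 0 := by
  have hpp : ∀ (a b : ℕ) (f : MvPolynomial ℕ F), MvPolynomial.pderiv a (MvPolynomial.pderiv b f)
      = MvPolynomial.pderiv b (MvPolynomial.pderiv a f) := by
    intro a b f
    have : ⁅MvPolynomial.pderiv (R := F) a, MvPolynomial.pderiv (R := F) b⁆ = 0 := by
      apply MvPolynomial.derivation_ext
      intro c
      simp [Derivation.commutator_apply, MvPolynomial.pderiv_X, Pi.single_apply]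
      split_ifs <;> simp
    have h := congrArg (fun D => D f) this
    simp only [Derivation.commutator_apply] at h
    exact sub_eq_zero.1 h
  have hpX : ∀ (a b : ℕ) (f : MvPolynomial ℕ F), MvPolynomial.pderiv a (MvPolynomial.X b * f)
      = MvPolynomial.X b * MvPolynomial.pderiv a f + if a = b then f else 0 := by
    intro a b f
    rw [MvPolynomial.pderiv_mul]
    by_cases h : a = b
    · subst h; simp; ring
    · rw [MvPolynomial.pderiv_X_of_ne (Ne.symm h)]; simp [h]
  apply LinearMap.ext
  intro f
  rcases Nat.mod_two_eq_zero_or_one i with hi | hi <;>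
  rcases Nat.mod_two_eq_zero_or_one j with hj | hj
  · rw [if_neg (by omega), if_neg (by omega)]
    simp [wW, hi, hj, hpp (i / 2) (j / 2)]
  · rw [if_neg (c := j % 2 = 0 ∧ i = j + 1) (by omega)]
    simp only [wW, hi, hj, if_true, one_ne_zero, if_false, LinearMap.sub_apply, Module.End.mul_apply,
      LinearMap.mulLeft_apply, Derivation.coeFn_coe, hpX]
    by_cases h : j = i + 1
    · have h2 : i / 2 = j / 2 := by omega
      simp [h, show (i + 1) / 2 = i / 2 by omega, hi, hj]
    · have h2 : i / 2 ≠ j / 2 := by omega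
      simp [h, h2]
  · rw [if_neg (by omega)]
    simp only [wW, hi, hj, if_true, one_ne_zero, if_false, LinearMap.sub_apply, Module.End.mul_apply,
      LinearMap.mulLeft_apply, Derivation.coeFn_coe, hpX]
    by_cases h : i = j + 1
    · have h2 : j / 2 = i / 2 := by omega
      simp [h, show (j + 1) / 2 = j / 2 by omega, hi, hj]
    · have h2 : j / 2 ≠ i / 2 := by omega
      simp [h, h2]
  · rw [if_neg (by omega), if_neg (by omega)]
    simp [wW, hi, hj]; ring

lemma wW_lt (i j : ℕ) (h : i < j) : wW F i * wW F j - wW F j * wW F i =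
    if i % 2 = 0 ∧ j = i + 1 then 1 else 0 := by
  rw [wW_comm, if_neg (c := j % 2 = 0 ∧ i = j + 1) (by omega)]

variable (F) in
noncomputable def psi : WW F →ₗ[F] F := MvPolynomial.lcoeff F 0 ∘ₗ LinearMap.applyₗ 1

lemma psi_one : psi F 1 = 1 := by
  simp [psi]

end wpart
end SerreLie


namespace SerreLie
open TensorProduct
set_option linter.unusedSimpArgs false
set_option linter.unusedSectionVars false

lemma nodup_perm {n : ℕ} (l : List (Fin n)) (h : l.Nodup) (hl : l.length = n) :
    ∃ ρ : Equiv.Perm (Fin n), l = List.ofFn ρ := by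
  have hinj : Function.Injective fun k : Fin n => l.get (k.cast hl.symm) := by
    intro a b hab
    have := List.nodup_iff_injective_get.1 h hab
    simpa [Fin.ext_iff] using this
  refine ⟨Equiv.ofBijective _ (Finite.injective_iff_bijective.1 hinj), ?_⟩
  apply List.ext_get
  · simp [hl]
  · intro i h1 h2
    simp

section kernelpart
variable {F : Type*} [CommRing F] {n : ℕ}

def dd (F : Type*) [CommRing F] {n : ℕ} (last : Fin n) (w : ℕ → Fin n) (j : Fin n) (k : ℕ) : F :=
  if j = last then -1 else if j = w k then 1 else 0

lemma prod_dd (last : Fin n) (w : ℕ → Fin n) (ρ : Equiv.Perm (Fin n))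
    (h : ∀ k : Fin n, ρ k = last ∨ ρ k = w k) : ∏ k : Fin n, dd F last w (ρ k) k = -1 := by
  have h1 : ∀ k : Fin n, dd F last w (ρ k) k = (fun i => if i = last then (-1 : F) else 1) (ρ k) := by
    intro k
    rcases h k with h | h
    · simp [dd, h]
    · simp only [dd, ← h, if_true]
  rw [Finset.prod_congr rfl fun k _ => h1 k, Equiv.prod_comp ρ (fun i => if i = last then (-1 : F) else 1)]
  simp

lemma b_swap (last : Fin n) (b : Equiv.Perm (Fin n) → F)
    (hb : ∀ w : ℕ → Fin n, (∀ k, w k ≠ last) → ∑ ρ, b ρ * ∏ k : Fin n, dd F last w (ρ k) k = 0)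
    (j : Fin n) (hj : j ≠ last) (ρ : Equiv.Perm (Fin n)) :
    b (Equiv.swap j last * ρ) = - b ρ := by
  let w : ℕ → Fin n := fun k => if h : k < n then (if ρ ⟨k, h⟩ = last then j else ρ ⟨k, h⟩) else j
  have hw : ∀ k : Fin n, w k = if ρ k = last then j else ρ k := by
    intro k; simp [w]
  have hwl : ∀ k, w k ≠ last := by
    intro k; simp only [w]; split_ifs <;> assumption
  have h0 := hb w hwl
  have hne : Equiv.swap j last * ρ ≠ ρ := by
    intro h
    have := mul_eq_right.1 h
    rw [Equiv.swap_eq_one_iff] at this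
    exact hj this
  rw [Finset.sum_eq_add (Equiv.swap j last * ρ) ρ hne] at h0
  · rw [prod_dd, prod_dd] at h0
    · linear_combination -h0
    · intro k; rw [hw]; split_ifs <;> simp [*]
    · intro k; rw [hw]; 
      by_cases h : ρ k = last
      · simp [h]
      · by_cases h' : ρ k = j
        · simp [h']
        · simp [h, Equiv.swap_apply_of_ne_of_ne h' h]
  · rintro σ - ⟨h1, h2⟩
    have : ∃ k : Fin n, σ k ≠ last ∧ σ k ≠ w k := by
      by_contra hcon
      push Not at hcon
      by_cases hk0 : σ (ρ.symm last) = last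
      · apply h2
        ext1 k
        by_cases hk : ρ k = last
        · rw [hk, ← hk0, ← hk]; simp
        · have : σ k ≠ last := by
            intro h
            apply hk
            rw [← hk0] at h
            rw [σ.injective h]; simp
          rw [hcon k this, hw, if_neg hk]
      · have e0 : σ (ρ.symm last) = j := by rw [hcon _ hk0, hw]; simp
        have ej : σ (ρ.symm j) = last := by
          by_contra h
          have := hcon _ h
          rw [hw, Equiv.apply_symm_apply, if_neg hj] at this
          have := ρ.symm.injective (σ.injective (this.trans e0.symm))
          exact hj this
        apply h1
        ext1 k
        rw [Equiv.Perm.mul_apply]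
        by_cases hk : ρ k = last
        · rw [hk, Equiv.swap_apply_right, ← e0, ← hk]; simp
        · by_cases hk' : ρ k = j
          · rw [hk', Equiv.swap_apply_left, ← ej, ← hk']; simp
          · rw [Equiv.swap_apply_of_ne_of_ne hk' hk]
            have : σ k ≠ last := by
              intro h
              apply hk'
              rw [← ej] at h
              rw [σ.injective h]; simp
            rw [hcon k this, hw, if_neg hk]
    obtain ⟨k, hk1, hk2⟩ := this
    rw [Finset.prod_eq_zero (Finset.mem_univ k), mul_zero]
    simp [dd, hk1, hk2]
  · simp
  · simp

lemma b_sign (last : Fin n) (b : Equiv.Perm (Fin n) → F)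
    (hb : ∀ w : ℕ → Fin n, (∀ k, w k ≠ last) → ∑ ρ, b ρ * ∏ k : Fin n, dd F last w (ρ k) k = 0)
    (ρ : Equiv.Perm (Fin n)) : b ρ = ((Equiv.Perm.sign ρ : ℤ) : F) * b 1 := by
  have hs := b_swap last b hb
  induction ρ using Equiv.Perm.swap_induction_on with
  | one => simp
  | swap_mul f x y hxy ih =>
    have : b (Equiv.swap x y * f) = - b f := by
      by_cases hx : x = last
      · subst hx; rw [Equiv.swap_comm]; exact hs y hxy.symm f
      · by_cases hy : y = last
        · subst hy; exact hs x hx f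
        · have e := Equiv.swap_mul_swap_mul_swap (x := y) (y := last) (z := x) hy hxy.symm
          rw [Equiv.swap_comm last x] at e
          rw [← e, mul_assoc, mul_assoc, hs x hx, hs y hy, hs x hx, neg_neg]
    rw [this, ih, Equiv.Perm.sign_mul, Equiv.Perm.sign_swap hxy]
    simp

/-! operators -/
variable (F) in
abbrev EE := Module.End F (ℕ → F)

noncomputable def sOp (F : Type*) [CommRing F] (last : Fin n) (w : ℕ → Fin n) (j : Fin n) : EE F where
  toFun g k := dd F last w j k * g (k + 1)
  map_add' g h := by ext k; simp [mul_add]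
  map_smul' c g := by ext k; simp; ring

lemma sOp_prod (last : Fin n) (w : ℕ → Fin n) (r : ℕ) (ρ : Fin r → Fin n) (g : ℕ → F) (j : ℕ) :
    (List.ofFn fun k => sOp F last w (ρ k)).prod g j =
      (∏ k : Fin r, dd F last w (ρ k) (j + k)) * g (j + r) := by
  induction r generalizing j with
  | zero => simp
  | succ r ih =>
    rw [List.ofFn_succ, List.prod_cons, Fin.prod_univ_succ, Module.End.mul_apply]
    show dd F last w (ρ 0) j * _ = _
    rw [ih (fun k => ρ k.succ)]
    simp only [Fin.val_zero, add_zero, Fin.val_succ]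
    rw [mul_assoc, show j + 1 + r = j + (r + 1) by omega,
      Finset.prod_congr rfl fun (k : Fin r) _ => show dd F last w (ρ k.succ) (j + 1 + k) =
        dd F last w (ρ k.succ) (j + (k + 1)) by rw [show j + 1 + (k : ℕ) = j + (k + 1) by omega]]

def Fil (F : Type*) [CommRing F] (r : ℕ) : Submodule F (EE F) where
  carrier := {T | ∀ (g : ℕ → F) (N : ℕ), (∀ j, N ≤ j → g j = 0) → ∀ k, N ≤ k + r → T g k = 0}
  add_mem' {a b} ha hb g N hg k hk := by
    rw [LinearMap.add_apply, Pi.add_apply, ha g N hg k hk, hb g N hg k hk, add_zero]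
  zero_mem' := by intro g N _ k _; simp
  smul_mem' c a ha g N hg k hk := by
    rw [LinearMap.smul_apply, Pi.smul_apply, ha g N hg k hk, smul_zero]

lemma Fil_mul {r s q : ℕ} {T S : EE F} (hT : T ∈ Fil F r) (hS : S ∈ Fil F s) (h : r + s = q) :
    T * S ∈ Fil F q := by
  intro g N hg k hk
  rw [Module.End.mul_apply]
  apply hT _ (N - s) _ k (by omega)
  intro j hj
  exact hS g N hg j (by omega)

lemma Fil_anti {r s : ℕ} (h : r ≤ s) : Fil F s ≤ Fil F r := 
  fun _ hT g N hg k hk => hT g N hg k (by omega)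

lemma sOp_Fil (last : Fin n) (w : ℕ → Fin n) (j : Fin n) : sOp F last w j ∈ Fil F 1 := by
  intro g N hg k hk
  show _ * g (k + 1) = 0
  rw [hg _ hk, mul_zero]

lemma Fil_cf {T : EE F} (hT : T ∈ Fil F (n + 1)) : T (Pi.single n 1) 0 = 0 := by
  apply hT _ (n + 1) _ 0 (by omega)
  intro j hj
  rw [Pi.single_eq_of_ne (by omega)]

variable (F n) in
abbrev FA := FreeAlgebra F (Fin n)

noncomputable def pw (F : Type*) [CommRing F] (last : Fin n) (w : ℕ → Fin n) : FA F n →ₐ[F] EE F :=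
  FreeAlgebra.lift F (sOp F last w)

noncomputable def yP (F : Type*) [CommRing F] (ρ : Equiv.Perm (Fin n)) : FA F n :=
  (List.ofFn fun k => FreeAlgebra.ι F (ρ k)).prod

noncomputable def Psi (F : Type*) [CommRing F] (n : ℕ) : FA F n →ₐ[F] WW F :=
  FreeAlgebra.lift F (fun i : Fin n => wW F i)

lemma kernel_main (p : ℕ) (last : Fin (2 * p)) (t : FA F (2 * p))
    (ht : t ∈ Submodule.span F (Set.range (yP F (n := 2 * p))))
    (h0 : ∀ w : ℕ → Fin (2 * p), (∀ k, w k ≠ last) → pw F last w t ∈ Fil F (2 * p + 1)) :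
    ∃ c : F, Psi F (2 * p) t = (c * (p.factorial : F)) • (1 : WW F) := by
  obtain ⟨b, rfl⟩ := (Submodule.mem_span_range_iff_exists_fun F).1 ht
  refine ⟨b 1, ?_⟩
  have hb := b_sign last b (by
    intro w hw
    have := Fil_cf (h0 w hw)
    rw [map_sum, LinearMap.sum_apply, Finset.sum_apply] at this
    rw [← this]
    refine Finset.sum_congr rfl fun ρ _ => ?_
    rw [map_smul, LinearMap.smul_apply, Pi.smul_apply, smul_eq_mul, yP, map_list_prod, List.map_ofFn]
    have e : (⇑(pw F last w) ∘ fun k => FreeAlgebra.ι F (ρ k)) = fun k => sOp F last w (ρ k) := by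
      ext1 k; simp [pw]
    rw [e, sOp_prod]
    simp)
  rw [map_sum]
  have e : ∀ ρ, Psi F (2 * p) (b ρ • yP F ρ) =
      b 1 • (((Equiv.Perm.sign ρ : ℤ) : F) • (List.ofFn fun k => wW F (ρ k)).prod) := by
    intro ρ
    rw [map_smul, yP, map_list_prod, List.map_ofFn, smul_smul, hb ρ, mul_comm]
    congr 3
    ext1 k
    simp [Psi]
  rw [Finset.sum_congr rfl fun ρ _ => e ρ, ← Finset.smul_sum, sum_sign_W p (wW F) wW_lt, smul_smul]

/-! left normed commutators -/
lemma lc_mem {T ι : Type*} [Ring T] [Algebra F T] (y : ι → T) (l0 l : List ι) (t : T)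
    (ht : t ∈ Submodule.span F {s | ∃ l' : List ι, l'.Perm l0 ∧ s = (l'.map y).prod}) :
    (l.map y).foldl (fun a b => a * b - b * a) t ∈
      Submodule.span F {s | ∃ l' : List ι, l'.Perm (l0 ++ l) ∧ s = (l'.map y).prod} := by
  induction l generalizing l0 t with
  | nil => simpa using ht
  | cons i l ih =>
    rw [List.map_cons, List.foldl_cons]
    have := ih (l0 ++ [i]) (t * y i - y i * t) ?_
    · simpa using this
    · have ht' := ht
      clear ih
      induction ht using Submodule.span_induction with
      | mem s hs =>
        obtain ⟨l', hl, rfl⟩ := hs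
        apply sub_mem
        · apply Submodule.subset_span
          exact ⟨l' ++ [i], hl.append_right _, by simp⟩
        · apply Submodule.subset_span
          refine ⟨i :: l', ?_, by simp⟩
          exact (hl.cons i).trans (List.perm_append_singleton i l0).symm
      | zero => simp
      | add a b _ _ h1 h2 =>
        have := add_mem (h1 ‹_›) (h2 ‹_›)
        convert this using 1; noncomm_ring
      | smul c a _ h1 =>
        have := Submodule.smul_mem _ c (h1 ‹_›)
        convert this using 1
        rw [smul_sub, smul_mul_assoc, mul_smul_comm]

lemma foldl_zero {T : Type*} [Ring T] (l : List T) :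
    l.foldl (fun a b => a * b - b * a) 0 = 0 := by
  induction l with
  | nil => rfl
  | cons a l ih => simpa using ih

lemma map_foldl_comm {T W : Type*} [Ring T] [Ring W] (θ : T →+* W) (l : List T) (t : T) :
    θ (l.foldl (fun a b => a * b - b * a) t) = (l.map θ).foldl (fun a b => a * b - b * a) (θ t) := by
  induction l generalizing t with
  | nil => rfl
  | cons a l ih => simp [ih]

lemma lc_W (a b c : ℕ) (l : List ℕ) :
    ((b :: c :: l).map (wW F)).foldl (fun a b => a * b - b * a) (wW F a) = 0 := by
  simp only [List.map_cons, List.foldl_cons]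
  rw [show (wW F a * wW F b - wW F b * wW F a) * wW F c - wW F c * (wW F a * wW F b - wW F b * wW F a)
    = 0 from ?_]
  · exact foldl_zero _
  · rw [wW_comm]
    split_ifs
    · rw [one_mul, mul_one, sub_self]
    · exact sub_eq_zero.2 (Commute.neg_one_left (wW F c))
    · rw [zero_mul, mul_zero, sub_self]

end kernelpart

section idealpart
variable {F : Type*} [CommRing F] {n : ℕ} {L : Type*} [LieRing L] [LieAlgebra F L]

structure Rep (last : Fin n) (x : Fin n → L) (f : (ℕ → Fin n) → L →ₗ[F] EE F) : Prop where
  lie : ∀ w, (∀ k, w k ≠ last) → ∀ a b, f w ⁅a, b⁆ = f w a * f w b - f w b * f w a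
  val : ∀ w, (∀ k, w k ≠ last) → ∀ j, f w (x j) = sOp F last w j
  fil : ∀ w, (∀ k, w k ≠ last) → ∀ a, f w a ∈ Fil F 1

def Good (last : Fin n) (f : (ℕ → Fin n) → L →ₗ[F] EE F) (t : FA F n) (r : ℕ) : Submodule F L where
  carrier := {a | ∃ c : F, ∀ w, (∀ k, w k ≠ last) → f w a - c • pw F last w t ∈ Fil F (r + 1)}
  add_mem' {a b} := by
    rintro ⟨c, hc⟩ ⟨d, hd⟩
    refine ⟨c + d, fun w hw => ?_⟩
    convert add_mem (hc w hw) (hd w hw) using 1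
    rw [map_add, add_smul]; abel
  zero_mem' := ⟨0, fun w hw => by simp⟩
  smul_mem' e a := by
    rintro ⟨c, hc⟩
    refine ⟨e * c, fun w hw => ?_⟩
    convert Submodule.smul_mem _ e (hc w hw) using 1
    rw [map_smul, smul_sub, smul_smul]

variable {last : Fin n} {x : Fin n → L} {f : (ℕ → Fin n) → L →ₗ[F] EE F}

lemma Good_I (hR : Rep last x f) (i : Fin n) (a : L)
    (ha : a ∈ LieSubmodule.lieSpan F L {x i}) : a ∈ Good last f (FreeAlgebra.ι F i) 1 := by
  induction ha using LieSubmodule.lieSpan_induction with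
  | mem a ha =>
    rw [Set.mem_singleton_iff] at ha
    subst ha
    refine ⟨1, fun w hw => ?_⟩
    rw [hR.val w hw]; simp [pw]
  | zero => exact zero_mem _
  | add a b _ _ h1 h2 => exact add_mem h1 h2
  | smul c a _ h => exact Submodule.smul_mem _ c h
  | lie b a _ h =>
    refine ⟨0, fun w hw => ?_⟩
    rw [zero_smul, sub_zero, hR.lie w hw]
    exact sub_mem (Fil_mul (hR.fil w hw _) (hR.fil w hw _) rfl) (Fil_mul (hR.fil w hw _) (hR.fil w hw _) rfl)

lemma Good_lie (hR : Rep last x f) (t s : FA F n) (r : ℕ)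
    (ht : ∀ w, pw F last w t ∈ Fil F r) (hs : ∀ w, pw F last w s ∈ Fil F 1) (a b : L)
    (ha : a ∈ Good last f t r) (hb : b ∈ Good last f s 1) :
    ⁅a, b⁆ ∈ Good last f (t * s - s * t) (r + 1) := by
  obtain ⟨c, hc⟩ := ha
  obtain ⟨d, hd⟩ := hb
  refine ⟨c * d, fun w hw => ?_⟩
  have hc := hc w hw
  have hd := hd w hw
  have hfb := hR.fil w hw b
  rw [hR.lie w hw, map_sub, map_mul, map_mul]
  have e : f w a * f w b - f w b * f w a - (c * d) • (pw F last w t * pw F last w s -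
      pw F last w s * pw F last w t) =
      c • (pw F last w t * (f w b - d • pw F last w s)) + (f w a - c • pw F last w t) * f w b
      - (c • ((f w b - d • pw F last w s) * pw F last w t) + f w b * (f w a - c • pw F last w t)) := by
    simp only [mul_sub, sub_mul, smul_sub, smul_mul_assoc, mul_smul_comm, mul_smul]
    abel
  rw [e]
  refine sub_mem (add_mem ?_ ?_) (add_mem ?_ ?_)
  · exact Submodule.smul_mem _ _ (Fil_mul (ht w) hd rfl)
  · exact Fil_mul hc hfb rfl
  · exact Submodule.smul_mem _ _ (Fil_mul hd (ht w) (by omega))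
  · exact Fil_mul hfb hc (by omega)

lemma Good_fold (hR : Rep last x f) (l : List (Fin n)) (t : FA F n) (r : ℕ)
    (ht : ∀ w, pw F last w t ∈ Fil F r) (J : LieIdeal F L) (hJ : ∀ a ∈ J, a ∈ Good last f t r)
    (a : L) (ha : a ∈ (l.map fun i => LieSubmodule.lieSpan F L {x i}).foldl
      (fun (x y : LieIdeal F L) => ⁅x, y⁆) J) :
    a ∈ Good last f ((l.map (FreeAlgebra.ι F)).foldl (fun a b => a * b - b * a) t) (r + l.length) := by
  induction l generalizing t r J with
  | nil => exact hJ a ha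
  | cons i l ih =>
    rw [List.map_cons, List.foldl_cons] at ha ⊢
    have hi : ∀ w, pw F last w (FreeAlgebra.ι F i) ∈ Fil F 1 := by
      intro w
      simp only [pw, FreeAlgebra.lift_ι_apply]
      exact sOp_Fil _ _ _
    have := ih (t * FreeAlgebra.ι F i - FreeAlgebra.ι F i * t) (r + 1) ?_ _ ?_ ha
    · rw [List.length_cons, ← add_assoc, add_right_comm]; exact this
    · intro w
      rw [map_sub, map_mul, map_mul]
      exact sub_mem (Fil_mul (ht w) (hi w) rfl) (Fil_mul (hi w) (ht w) (by omega))
    · intro b hb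
      rw [← LieSubmodule.mem_toSubmodule, LieSubmodule.lieIdeal_oper_eq_linear_span'] at hb
      have hle : Submodule.span F {m | ∃ x_1 ∈ J, ∃ n ∈ LieSubmodule.lieSpan F L {x i}, ⁅x_1, n⁆ = m} ≤
        Good last f (t * FreeAlgebra.ι F i - FreeAlgebra.ι F i * t) (r + 1) := by
        rw [Submodule.span_le]
        rintro _ ⟨c, hc, d, hd, rfl⟩
        exact Good_lie hR t _ r ht hi c d (hJ c hc) (Good_I hR i d hd)
      exact hle hb

lemma sym_good (hn : 3 ≤ n) (hR : Rep last x f) (a : L)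
    (ha : a ∈ ⨆ ρ : Equiv.Perm (Fin n),
      leftBracketIdeal (List.ofFn fun k => LieSubmodule.lieSpan F L {x (ρ k)})) :
    ∃ t ∈ Submodule.span F (Set.range (yP F (n := n))), Psi F n t = 0 ∧
      ∀ w, (∀ k, w k ≠ last) → f w a - pw F last w t ∈ Fil F (n + 1) := by
  induction ha using LieSubmodule.iSup_induction' with
  | mem ρ a ha =>
    obtain ⟨i, j, k, l, hl⟩ : ∃ i j k l, List.ofFn ρ = i :: j :: k :: l := by
      have : 3 ≤ (List.ofFn ρ).length := by simpa using hn
      match h : List.ofFn ρ, this with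
      | i :: j :: k :: l, _ => exact ⟨i, j, k, l, rfl⟩
    have e : (List.ofFn fun k => LieSubmodule.lieSpan F L {x (ρ k)}) =
      (List.ofFn ρ).map fun i => LieSubmodule.lieSpan F L {x i} := by rw [List.map_ofFn]; rfl
    rw [e, hl, List.map_cons, leftBracketIdeal] at ha
    have hg := Good_fold hR (j :: k :: l) (FreeAlgebra.ι F i) 1 (by
      intro w
      simp only [pw, FreeAlgebra.lift_ι_apply]
      exact sOp_Fil _ _ _) _ (fun a ha => Good_I hR i a ha) a ha
    obtain ⟨c, hc⟩ := hg
    have hlen : 1 + (j :: k :: l).length = n := by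
      have := congrArg List.length hl
      simp at this ⊢; omega
    rw [hlen] at hc
    refine ⟨c • ((j :: k :: l).map (FreeAlgebra.ι F)).foldl (fun a b => a * b - b * a)
      (FreeAlgebra.ι F i), Submodule.smul_mem _ c ?_, ?_, fun w hw => ?_⟩
    · have := lc_mem (F := F) (FreeAlgebra.ι F) [i] (j :: k :: l) (FreeAlgebra.ι F i)
        (Submodule.subset_span ⟨[i], List.Perm.refl _, by simp⟩)
      refine Submodule.span_mono ?_ this
      rintro _ ⟨l', hl', rfl⟩
      rw [List.singleton_append, ← hl] at hl'
      have hnd : l'.Nodup := hl'.nodup_iff.2 (List.nodup_ofFn.2 ρ.injective)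
      have hlen : l'.length = n := by rw [hl'.length_eq]; simp
      obtain ⟨σ, hσ⟩ := nodup_perm l' hnd hlen
      refine ⟨σ, ?_⟩
      rw [yP, hσ, List.map_ofFn]
      rfl
    · rw [map_smul]
      have := map_foldl_comm (Psi F n).toRingHom ((j :: k :: l).map (FreeAlgebra.ι F)) (FreeAlgebra.ι F i)
      have h2 := lc_W (F := F) i j k (l.map fun i : Fin n => (i : ℕ))
      rw [show Psi F n _ = 0 from this.trans ?_, smul_zero]
      rw [← h2]
      simp [Psi, Function.comp_def]
    · rw [map_smul]; exact hc w hw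
  | zero => exact ⟨0, zero_mem _, map_zero _, fun w hw => by simp⟩
  | add a b _ _ h1 h2 =>
    obtain ⟨t, ht, ht0, h1⟩ := h1
    obtain ⟨s, hs, hs0, h2⟩ := h2
    refine ⟨t + s, add_mem ht hs, by rw [map_add, ht0, hs0, add_zero], fun w hw => ?_⟩
    convert add_mem (h1 w hw) (h2 w hw) using 1
    rw [map_add, map_add]; abel

lemma not_sym (p : ℕ) (hp : 2 ≤ p) {last : Fin (2 * p)} {x : Fin (2 * p) → L}
    {f : (ℕ → Fin (2 * p)) → L →ₗ[F] EE F} (hR : Rep last x f) (a : L) (t : FA F (2 * p))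
    (ht : t ∈ Submodule.span F (Set.range (yP F (n := 2 * p))))
    (hta : ∀ w, (∀ k, w k ≠ last) → f w a = pw F last w t)
    (c0 : F) (hc0 : Psi F (2 * p) t = c0 • 1)
    (ha : a ∈ ⨆ ρ : Equiv.Perm (Fin (2 * p)),
      leftBracketIdeal (List.ofFn fun k => LieSubmodule.lieSpan F L {x (ρ k)})) :
    ∃ c : F, c0 = c * (p.factorial : F) := by
  obtain ⟨s, hs, hs0, h⟩ := sym_good (by omega) hR a ha
  obtain ⟨c, hc⟩ := kernel_main p last (t - s) (sub_mem ht hs) (by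
    intro w hw
    rw [map_sub, ← hta w hw]; exact h w hw)
  refine ⟨c, ?_⟩
  rw [map_sub, hs0, sub_zero, hc0] at hc
  have := congrArg (psi F) hc
  simpa [psi_one] using this

end idealpart
end SerreLie


namespace SerreLie
open TensorProduct
set_option linter.unusedSimpArgs false
set_option linter.unusedSectionVars false

def eLab (p : ℕ) (hp : 2 ≤ p) : Lab (2 * (p - 1)) → Fin (2 * p) :=
  Sum.elim (fun i => ⟨i, by omega⟩) (fun k => ⟨2 * p - 2 + k, by omega⟩)

lemma eLab_inj (p : ℕ) (hp : 2 ≤ p) : Function.Injective (eLab p hp) := by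
  rintro (a | a) (b | b) h <;> simp only [eLab, Sum.elim_inl, Sum.elim_inr, Fin.mk.injEq] at h
  · rw [Fin.ext h]
  · omega
  · omega
  · have : (a : ℕ) = b := by omega
    rw [Fin.ext this]

lemma eLab_sum {M : Type*} [AddCommMonoid M] (p : ℕ) (hp : 2 ≤ p) (x : Fin (2 * p) → M) :
    ∑ i, x i = ∑ i, x (eLab p hp (Sum.inl i)) + x (eLab p hp (Sum.inr 0)) + x (eLab p hp (Sum.inr 1)) := by
  have hb : Function.Bijective (eLab p hp) := by
    rw [Fintype.bijective_iff_injective_and_card]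
    refine ⟨eLab_inj p hp, ?_⟩
    simp; omega
  rw [← hb.sum_comp, Fintype.sum_sum_type, Fin.sum_univ_two, add_assoc]

lemma elim_eq {M : Type*} (p : ℕ) (hp : 2 ≤ p) (x : Fin (2 * p) → M) :
    Sum.elim (fun i => x (eLab p hp (Sum.inl i))) ![x (eLab p hp (Sum.inr 0)), x (eLab p hp (Sum.inr 1))]
      = fun a => x (eLab p hp a) := by
  ext1 a
  rcases a with a | a
  · rfl
  · fin_cases a <;> rfl

lemma flat_get {α : Type*} (q : List (α × α)) (k : ℕ) (h : k < q.length) :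
    (q.flatMap fun a => [a.1, a.2])[2 * k]? = some q[k].1 ∧
    (q.flatMap fun a => [a.1, a.2])[2 * k + 1]? = some q[k].2 := by
  induction q generalizing k with
  | nil => simp at h
  | cons a q ih =>
    rcases k with _ | k
    · simp
    · have := ih k (by simpa using h)
      rw [show 2 * (k + 1) = 2 * k + 1 + 1 by ring]
      simpa using this

section memb
variable {F : Type*} [CommRing F] {p : ℕ} {A : Type*} [Ring A] [Algebra F A]

lemma word_span (hp : 2 ≤ p) (x : Fin (2 * p) → A) :
    TopA (NA F p (fun i => x (eLab p hp (Sum.inl i))) (x (eLab p hp (Sum.inr 0))) (x (eLab p hp (Sum.inr 1))))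
     ∈ Submodule.span F {t | ∃ ρ : Equiv.Perm (Fin (2 * p)), t = (List.ofFn fun k => x (ρ k)).prod} := by
  have h := Hs_top le_rfl le_rfl (NA_word (F := F) p rfl (fun i => x (eLab p hp (Sum.inl i)))
    (x (eLab p hp (Sum.inr 0))) (x (eLab p hp (Sum.inr 1))))
  refine Submodule.span_mono ?_ h
  rintro _ ⟨l, ht, hn, rfl⟩
  have e : l.flatMap (fun i => [i]) = l := by simp
  rw [e] at ht hn
  obtain ⟨ρ, hρ⟩ := nodup_perm (l.map (eLab p hp)) (hn.map (eLab_inj p hp)) (by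
    rw [List.length_map, length_of_type ht]; omega)
  refine ⟨ρ, ?_⟩
  rw [elim_eq]
  have : (l.map fun a => x (eLab p hp a)) = (l.map (eLab p hp)).map x := by simp
  rw [this, hρ, List.map_ofFn]
  rfl

lemma com_span (hp : 2 ≤ p) (x : Fin (2 * p) → A) :
    TopA (NA F p (fun i => x (eLab p hp (Sum.inl i))) (x (eLab p hp (Sum.inr 0))) (x (eLab p hp (Sum.inr 1))))
     ∈ Submodule.span F {t | ∃ ρ : Equiv.Perm (Fin (2 * p)), t = (List.ofFn fun k : Fin p =>
        x (ρ ⟨2 * k, by omega⟩) * x (ρ ⟨2 * k + 1, by omega⟩) -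
        x (ρ ⟨2 * k + 1, by omega⟩) * x (ρ ⟨2 * k, by omega⟩)).prod} := by
  have h := Hs_top le_rfl le_rfl (NA_com (F := F) p rfl (fun i => x (eLab p hp (Sum.inl i)))
    (x (eLab p hp (Sum.inr 0))) (x (eLab p hp (Sum.inr 1))))
  refine Submodule.span_mono ?_ h
  rintro _ ⟨q, ht, hn, rfl⟩
  have hlen : (q.flatMap clab).length = 2 * p := by rw [length_of_type ht]; omega
  have hq : q.length = p := by
    have : (q.flatMap clab).length = 2 * q.length := by
      clear ht hn hlen h
      induction q with
      | nil => simp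
      | cons a q ih => rw [List.flatMap_cons, List.length_append, ih]; simp [clab]; ring
    omega
  obtain ⟨ρ, hρ⟩ := nodup_perm ((q.flatMap clab).map (eLab p hp)) (hn.map (eLab_inj p hp)) (by
    rw [List.length_map, hlen])
  refine ⟨ρ, ?_⟩
  rw [elim_eq]
  congr 1
  apply List.ext_getElem
  · simp [hq]
  · intro k h1 h2
    have hk : k < q.length := by simpa using h1
    have hk' : k < p := by omega
    obtain ⟨f1, f2⟩ := flat_get q k hk
    have e1 := congrArg (fun l => l[2 * k]?) hρ
    have e2 := congrArg (fun l => l[2 * k + 1]?) hρ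
    have c : clab = fun a : Lab (2 * (p - 1)) × Lab (2 * (p - 1)) => [a.1, a.2] := rfl
    simp only [List.getElem?_map, c, f1, f2, Option.map_some, List.getElem?_ofFn] at e1 e2
    rw [dif_pos (by omega), Option.some_inj] at e1 e2
    simp only [List.getElem_map, List.getElem_ofFn, cval, e1, e2]

end memb

section alg
variable {F : Type*} [CommRing F] {L : Type*} [LieRing L] [LieAlgebra F L]

lemma ad_word {n : ℕ} (x : Fin n → L) (l : List (Fin n)) (i0 : Fin n) :
    (l.map fun i => (LieAlgebra.ad F L (x i) : Module.End F L)).prod (x i0) ∈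
      leftBracketIdeal ((i0 :: l.reverse).map fun i => LieSubmodule.lieSpan F L {x i}) := by
  induction l with
  | nil =>
    simp only [List.map_nil, List.prod_nil, List.reverse_nil, List.map_cons, leftBracketIdeal,
      List.foldl_nil]
    exact LieSubmodule.subset_lieSpan (by simp)
  | cons i l ih =>
    rw [show ((i :: l).map fun i => (LieAlgebra.ad F L (x i) : Module.End F L)) = (LieAlgebra.ad F L (x i) : Module.End F L) ::
      l.map (fun i => (LieAlgebra.ad F L (x i) : Module.End F L)) from rfl,
      List.prod_cons, Module.End.mul_apply, LieAlgebra.ad_apply, ← lie_skew]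
    rw [List.reverse_cons, List.map_cons, List.map_append, leftBracketIdeal, List.foldl_append]
    apply neg_mem
    simp only [List.map_cons, List.map_nil, List.foldl_cons, List.foldl_nil]
    rw [List.map_cons, leftBracketIdeal] at ih
    exact LieSubmodule.lie_mem_lie ih (LieSubmodule.subset_lieSpan (by simp))

lemma K_memb (p : ℕ) (hp : 2 ≤ p) (x : Fin (2 * p) → L) (hx : ∑ i, x i = 0) :
    (TopA (Kf (uL F (fun i => x (eLab p hp (Sum.inl i))) ^ 2)
      (uL F (fun i => x (eLab p hp (Sum.inl i))) * yL F (x (eLab p hp (Sum.inr 0))) -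
        yL F (x (eLab p hp (Sum.inr 0))) * uL F (fun i => x (eLab p hp (Sum.inl i)))) (p - 1)
      * uL F (fun i => x (eLab p hp (Sum.inl i))))) (x (eLab p hp (Sum.inr 0))) ∈
    ⨆ ρ : Equiv.Perm (Fin (2 * p)),
      leftBracketIdeal (List.ofFn fun k => LieSubmodule.lieSpan F L {x (ρ k)}) := by
  let X : Fin (2 * p) → Module.End F L := fun i => LieAlgebra.ad F L (x i)
  have hX : ∑ i, X i = 0 := by
    have := congrArg (fun t => (LieAlgebra.ad F L t : Module.End F L)) hx
    simpa [X] using this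
  have h0 := K_eq (F := F) p rfl (fun i => X (eLab p hp (Sum.inl i))) (X (eLab p hp (Sum.inr 0)))
    (X (eLab p hp (Sum.inr 1))) (by rw [← eLab_sum, hX])
  have h1 : (TopA (Kf (uL F (fun i => x (eLab p hp (Sum.inl i))) ^ 2)
      (uL F (fun i => x (eLab p hp (Sum.inl i))) * yL F (x (eLab p hp (Sum.inr 0))) -
        yL F (x (eLab p hp (Sum.inr 0))) * uL F (fun i => x (eLab p hp (Sum.inl i)))) (p - 1)
      * uL F (fun i => x (eLab p hp (Sum.inl i))))) = _ := congrArg TopA h0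
  rw [h1, map_add, TopA_mul_c, LinearMap.add_apply, Module.End.mul_apply]
  have h2 : X (eLab p hp (Sum.inr 0)) (x (eLab p hp (Sum.inr 0))) = 0 := by
    simp [X]
  rw [h2, map_zero, zero_add]
  have h3 := Hs_top (by omega) le_rfl (K_word (F := F) p hp rfl (fun i => X (eLab p hp (Sum.inl i)))
    (X (eLab p hp (Sum.inr 0))) (X (eLab p hp (Sum.inr 1))))
  rw [elim_eq p hp X] at h3
  have h4 : Submodule.span F {t | ∃ l : List (Lab (2 * (p - 1))),
      HasType (l.flatMap fun i => [i]) (2 * (p - 1)) 0 1 ∧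
      (l.flatMap fun i => [i]).Nodup ∧ t = (l.map fun a => X (eLab p hp a)).prod} ≤
      (⨆ ρ : Equiv.Perm (Fin (2 * p)), leftBracketIdeal
        (List.ofFn fun k => LieSubmodule.lieSpan F L {x (ρ k)})).toSubmodule.comap
        (LinearMap.applyₗ (x (eLab p hp (Sum.inr 0)))) := by
    rw [Submodule.span_le]
    rintro _ ⟨l, ht, hn, rfl⟩
    have e : l.flatMap (fun i => [i]) = l := by simp
    rw [e] at ht hn
    have h5 := ad_word (F := F) x (l.map (eLab p hp)) (eLab p hp (Sum.inr 0))
    obtain ⟨ρ, hρ⟩ := nodup_perm (eLab p hp (Sum.inr 0) :: (l.map (eLab p hp)).reverse) (by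
      rw [List.nodup_cons, List.nodup_reverse]
      refine ⟨?_, hn.map (eLab_inj p hp)⟩
      rw [List.mem_reverse, List.mem_map]
      rintro ⟨a, ha, hae⟩
      have := eLab_inj p hp hae
      subst this
      exact List.count_eq_zero.1 ht.2.1 ha) (by
      rw [List.length_cons, List.length_reverse, List.length_map, length_of_type ht]; omega)
    rw [hρ, List.map_ofFn, List.map_map] at h5
    exact LieSubmodule.mem_iSup_of_mem ρ h5
  exact h4 h3

end alg

section main
variable {F : Type*} [CommRing F] {L : Type*} [LieRing L] [LieAlgebra F L]

section loc
attribute [local instance 100] LieRing.ofAssociativeRing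

lemma iota_lie (a b : L) : UniversalEnvelopingAlgebra.ι F ⁅a, b⁆ =
    UniversalEnvelopingAlgebra.ι F a * UniversalEnvelopingAlgebra.ι F b -
    UniversalEnvelopingAlgebra.ι F b * UniversalEnvelopingAlgebra.ι F a := by
  rw [LieHom.map_lie, LieRing.of_associative_ring_bracket]

lemma iota_add (a b : L) : UniversalEnvelopingAlgebra.ι F (a + b) =
    UniversalEnvelopingAlgebra.ι F a + UniversalEnvelopingAlgebra.ι F b := map_add _ a b

lemma iota_smul (c : F) (b : L) : UniversalEnvelopingAlgebra.ι F (c • b) =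
    c • UniversalEnvelopingAlgebra.ι F b := map_smul _ c b

end loc

lemma exists_lift {B : Type*} [Ring B] [Algebra F B] (f : L →ₗ[F] B)
    (hf : ∀ a b, f ⁅a, b⁆ = f a * f b - f b * f a) :
    ∃ θ : UniversalEnvelopingAlgebra F L →ₐ[F] B, ∀ a, θ (UniversalEnvelopingAlgebra.ι F a) = f a := by
  letI : LieRing B := LieRing.ofAssociativeRing
  refine ⟨UniversalEnvelopingAlgebra.lift F ({ f with map_lie' := ?_ } : L →ₗ⁅F⁆ B), fun a => ?_⟩
  · intro a b
    rw [LieRing.of_associative_ring_bracket]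
    exact hf a b
  · rw [UniversalEnvelopingAlgebra.lift_ι_apply]; rfl

lemma generic_main (p : ℕ) (hp : p.Prime) (x : Fin (2 * p) → L) (hx : ∑ i, x i = 0) :
    ∃ α : L, p • α ∈ (⨆ ρ : Equiv.Perm (Fin (2 * p)),
      leftBracketIdeal (List.ofFn fun k => LieSubmodule.lieSpan F L {x (ρ k)}) : LieIdeal F L) ∧
    UniversalEnvelopingAlgebra.ι F α ∈ Submodule.span F {t | ∃ ρ : Equiv.Perm (Fin (2 * p)),
      t = (List.ofFn fun k => UniversalEnvelopingAlgebra.ι F (x (ρ k))).prod} ∧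
    UniversalEnvelopingAlgebra.ι F α ∈ Submodule.span F {t | ∃ ρ : Equiv.Perm (Fin (2 * p)),
      t = (List.ofFn fun k : Fin p =>
        UniversalEnvelopingAlgebra.ι F (x (ρ ⟨2 * k, by omega⟩)) *
          UniversalEnvelopingAlgebra.ι F (x (ρ ⟨2 * k + 1, by omega⟩)) -
        UniversalEnvelopingAlgebra.ι F (x (ρ ⟨2 * k + 1, by omega⟩)) *
          UniversalEnvelopingAlgebra.ι F (x (ρ ⟨2 * k, by omega⟩))).prod} ∧
    ∀ (last : Fin (2 * p)) (f : (ℕ → Fin (2 * p)) → L →ₗ[F] EE F), Rep last x f →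
      α ∈ (⨆ ρ : Equiv.Perm (Fin (2 * p)),
        leftBracketIdeal (List.ofFn fun k => LieSubmodule.lieSpan F L {x (ρ k)}) : LieIdeal F L) →
      ∃ c : F, ((p - 1).factorial : F) = c * (p.factorial : F) := by
  have hp2 := hp.two_le
  let φ : L →ₗ[F] UniversalEnvelopingAlgebra F L :=
    { toFun := fun a => UniversalEnvelopingAlgebra.ι F a
      map_add' := fun a b => iota_add a b
      map_smul' := fun c a => iota_smul c a }
  obtain ⟨α, h1, h2⟩ := alpha_exists (F := F) p hp rfl φ iota_lie
    (fun i => x (eLab p hp2 (Sum.inl i))) (x (eLab p hp2 (Sum.inr 0)))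
  have hφx : ∑ i, φ (x i) = 0 := by rw [← map_sum, hx, map_zero]
  rw [h_identity hp, P_eq_N (F := F) p rfl (fun i => φ (x (eLab p hp2 (Sum.inl i))))
    (φ (x (eLab p hp2 (Sum.inr 0)))) (φ (x (eLab p hp2 (Sum.inr 1)))) (by
      rw [← eLab_sum p hp2 (fun i => φ (x i)), hφx])] at h2
  refine ⟨α, ?_, ?_, ?_, ?_⟩
  · rw [h1]; exact K_memb p hp2 x hx
  · have := word_span (F := F) hp2 (fun i => φ (x i))
    rw [← h2] at this
    exact this
  · have := com_span (F := F) hp2 (fun i => φ (x i))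
    rw [← h2] at this
    exact this
  · intro last f hR ha
    refine not_sym p hp2 hR α (TopA (NA F p (fun i => FreeAlgebra.ι F (eLab p hp2 (Sum.inl i)))
      (FreeAlgebra.ι F (eLab p hp2 (Sum.inr 0))) (FreeAlgebra.ι F (eLab p hp2 (Sum.inr 1))))) ?_ ?_
      ((p - 1).factorial : F) ?_ ha
    · have := word_span (F := F) hp2 (fun i => FreeAlgebra.ι F i)
      refine Submodule.span_mono ?_ this
      rintro _ ⟨ρ, rfl⟩
      exact ⟨ρ, rfl⟩
    · intro w hw
      obtain ⟨θ, hθ⟩ := exists_lift (f w) (hR.lie w hw)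
      have hθ' : ∀ j, θ (φ (x j)) = sOp F last w j := fun j => (hθ _).trans (hR.val w hw j)
      rw [← hθ]
      refine (congrArg θ h2).trans ?_
      rw [← TopA_mapA, ← TopA_mapA, mapA_NA, mapA_NA]
      simp only [hθ', pw, FreeAlgebra.lift_ι_apply]
    · rw [← TopA_mapA, mapA_NA]
      simp only [Psi, FreeAlgebra.lift_ι_apply]
      have e0 : ((eLab p hp2 (Sum.inr 0) : Fin (2 * p)) : ℕ) = 2 * p - 2 := by simp [eLab]
      have e1 : ((eLab p hp2 (Sum.inr 1) : Fin (2 * p)) : ℕ) = 2 * p - 1 := by simp [eLab]; omega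
      have e2 : ∀ i, ((eLab p hp2 (Sum.inl i) : Fin (2 * p)) : ℕ) = i := by intro i; simp [eLab]
      have h := NA_W (F := F) p hp (wW F) wW_lt
      simp only [e0, e1, e2]
      exact h

end main
end SerreLie


namespace SerreLie
set_option linter.unusedSimpArgs false
set_option linter.unusedSectionVars false

lemma sum_last {M : Type*} [AddCommMonoid M] (N n : ℕ) (h : n = N + 1) (g : Fin n → M) :
    ∑ i, g i = ∑ j : Fin N, g ⟨j, by omega⟩ + g ⟨N, by omega⟩ := by
  subst h
  rw [Fin.sum_univ_castSucc]
  rfl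

section loc8
variable {F : Type*} [CommRing F]

lemma sum_sOp {n : ℕ} (last : Fin n) (w : ℕ → Fin n) (hw : ∀ k, w k ≠ last) :
    ∑ j, sOp F last w j = 0 := by
  apply LinearMap.ext
  intro g
  funext k
  rw [LinearMap.sum_apply, Finset.sum_apply]
  show ∑ j, dd F last w j k * g (k + 1) = 0
  rw [← Finset.sum_mul]
  have : ∑ j, dd F last w j k = 0 := by
    have : ∀ j, dd F last w j k = (if j = last then -1 else 0) + (if j = w k then 1 else 0) := by
      intro j
      unfold dd
      by_cases h : j = last
      · subst h; simp [(hw k).symm]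
      · simp [h]
    simp [this, Finset.sum_add_distrib]
  rw [this, zero_mul]

attribute [local instance 100] LieRing.ofAssociativeRing

def FilLie (F : Type*) [CommRing F] : LieSubalgebra F (EE F) where
  toSubmodule := Fil F 1
  lie_mem' := by
    intro a b ha hb
    rw [LieRing.of_associative_ring_bracket]
    exact sub_mem (Fil_anti (by omega) (Fil_mul ha hb rfl)) (Fil_anti (by omega) (Fil_mul hb ha rfl))

lemma free_rep {X : Type*} (s : X → EE F) (hs : ∀ j, s j ∈ Fil F 1) :
    ∃ f : FreeLieAlgebra F X → EE F, (∀ a b, f (a + b) = f a + f b) ∧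
      (∀ a b, f ⁅a, b⁆ = f a * f b - f b * f a) ∧ (∀ j, f (FreeLieAlgebra.of F j) = s j) ∧
      ∀ a, f a ∈ Fil F 1 := by
  let g : FreeLieAlgebra F X →ₗ⁅F⁆ FilLie F := FreeLieAlgebra.lift F (fun j => ⟨s j, hs j⟩)
  refine ⟨fun a => (g a : EE F), fun a b => ?_, fun a b => ?_, fun j => ?_, fun a => (g a).2⟩
  · simp
  · show ((g ⁅a, b⁆ : FilLie F) : EE F) = _
    rw [LieHom.map_lie, LieSubalgebra.coe_bracket, LieRing.of_associative_ring_bracket]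
  · simp [g, FreeLieAlgebra.lift_of_apply]

end loc8

lemma xL_sum (p : ℕ) (hp : 2 ≤ p) : ∑ i, xL p i = 0 := by
  rw [sum_last (2 * p - 1) (2 * p) (by omega)]
  have h1 : ∀ j : Fin (2 * p - 1), xL p ⟨j, by omega⟩ = FreeLieAlgebra.of ℤ j := by
    intro j; simp [xL]
  simp only [h1]
  simp [xL]

lemma xL_rep (p : ℕ) (hp : 2 ≤ p) : ∃ f : (ℕ → Fin (2 * p)) →
    FreeLieAlgebra ℤ (Fin (2 * p - 1)) →ₗ[ℤ] EE ℤ,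
    Rep (⟨2 * p - 1, by omega⟩ : Fin (2 * p)) (xL p) f := by
  choose f h1 h2 h3 h4 using fun w : ℕ → Fin (2 * p) => free_rep (F := ℤ)
    (fun j : Fin (2 * p - 1) => sOp ℤ (⟨2 * p - 1, by omega⟩ : Fin (2 * p)) w ⟨j, by omega⟩)
    (fun j => sOp_Fil _ _ _)
  let f' : (ℕ → Fin (2 * p)) → FreeLieAlgebra ℤ (Fin (2 * p - 1)) →+ EE ℤ := fun w =>
    AddMonoidHom.mk' (f w) (h1 w)
  refine ⟨fun w => { f' w with map_smul' := fun c a => ?_ }, ?_, ?_, ?_⟩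
  · have := map_zsmul (f' w) c a
    simpa using this
  · intro w _; exact h2 w
  · intro w hw j
    show f' w (xL p j) = _
    have hv : ∀ j : Fin (2 * p - 1), f' w (xL p ⟨j, by omega⟩) = sOp ℤ (⟨2 * p - 1, by omega⟩ : Fin (2 * p)) w ⟨j, by omega⟩ := by
      intro j
      have : xL p ⟨j, by omega⟩ = FreeLieAlgebra.of ℤ j := by simp [xL]
      rw [this]
      exact h3 w j
    by_cases hj : (j : ℕ) < 2 * p - 1
    · exact hv ⟨j, hj⟩
    · have hj' : j = ⟨2 * p - 1, Nat.sub_lt (by omega) one_pos⟩ := by ext; simp; omega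
      rw [hj']
      have e1 := sum_sOp (F := ℤ) _ w hw
      have e2 := congrArg (f' w) (xL_sum p hp)
      rw [sum_last (2 * p - 1) (2 * p) (by omega)] at e1
      rw [map_zero, map_sum, sum_last (2 * p - 1) (2 * p) (by omega)] at e2
      simp only [hv] at e2
      rw [← e1] at e2
      exact add_left_cancel e2
  · intro w _; exact h4 w

lemma list_prod_mem {A : Type*} [Ring A] [Algebra ℤ A] {n : ℕ} (I : Fin n → Submodule ℤ A)
    (x : Fin n → A) (hx : ∀ k, x k ∈ I k) : (List.ofFn x).prod ∈ (List.ofFn I).prod := by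
  induction n with
  | zero => simpa using Submodule.one_le.1 le_rfl
  | succ n ih =>
    rw [List.ofFn_succ, List.ofFn_succ, List.prod_cons, List.prod_cons]
    exact Submodule.mul_mem_mul (hx 0) (ih _ _ fun k => hx k.succ)

lemma x_mem_iIdeal (p : ℕ) (i : Fin (2 * p)) : UniversalEnvelopingAlgebra.ι ℤ (xL p i) ∈ iIdeal p i :=
  Submodule.subset_span ⟨1, 1, by rw [one_mul, mul_one]⟩

end SerreLie


open SerreLie

/-- For every prime `p` there is an element `α_p` of the free Lie `ℤ`-algebra `L` with:
(i) `ι(α_p) ∈ (𝔦_0, …, 𝔦_{2p-1})_Σ`; (ii) `α_p ∉ [I_0, …, I_{2p-1}]_Σ`;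
(iii) `p·α_p ∈ [I_0, …, I_{2p-1}]_Σ`; and (iv) `ι(α_p)` lies in the sum over all
permutations of the products of pairwise commutators of the ideals `𝔦_i`. -/
theorem exists_serre_element_lie (hp : p.Prime) :
    ∃ α : FreeLieAlgebra ℤ (Fin (2 * p - 1)),
      (UniversalEnvelopingAlgebra.ι ℤ α ∈ symProdLie p) ∧
      (α ∉ symCommLie p) ∧
      ((p : ℤ) • α ∈ symCommLie p) ∧
      (UniversalEnvelopingAlgebra.ι ℤ α ∈ symCommProdLie p) := by
  have hp2 := hp.two_le
  obtain ⟨α, h3, h1, h4, h2⟩ := generic_main (F := ℤ) p hp (xL p) (xL_sum p hp2)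
  refine ⟨α, ?_, ?_, ?_, ?_⟩
  · refine (Submodule.span_le (p := symProdLie p)).2 ?_ h1
    rintro _ ⟨ρ, rfl⟩
    refine Submodule.mem_iSup_of_mem ρ ?_
    exact list_prod_mem _ _ fun k => x_mem_iIdeal p (ρ k)
  · intro h
    obtain ⟨f, hf⟩ := xL_rep p hp2
    obtain ⟨c, hc⟩ := h2 _ f hf h
    have h5 : (p.factorial : ℤ) ∣ ((p - 1).factorial : ℤ) := ⟨c, by rw [hc, mul_comm]⟩
    have h6 : p.factorial ∣ (p - 1).factorial := by exact_mod_cast h5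
    have h7 := (hp.dvd_factorial (n := p - 1)).1 ((Nat.dvd_factorial hp.pos le_rfl).trans h6)
    omega
  · rw [natCast_zsmul]; exact h3
  · refine (Submodule.span_le (p := symCommProdLie p)).2 ?_ h4
    rintro _ ⟨ρ, rfl⟩
    refine Submodule.mem_iSup_of_mem ρ ?_
    refine list_prod_mem _ _ fun k => ?_
    exact Submodule.subset_span ⟨_, x_mem_iIdeal p _, _, x_mem_iIdeal p _, rfl⟩
end

section
/- Let G be the group with generators e_0, e_1, e_2, z and relations e_0^4 = [z, e_1]·[z, e_2]^2, e_1^{16} = [z, e_0]^{−1}·[z, e_2]^4, e_2^{64} = [z, e_0]^{−2}·[z, e_1]^{−4} (i.e. G is the quotient of the free group on e_0, e_1, e_2, z by the normal closure of the corresponding three relators). Then the element α := [e_0, e_1]^{32}·[e_0, e_2]^{64}·[e_1, e_2]^{128} belongs to δ_4(G) but not to γ_4(G). -/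
open scoped commutatorElement

/-- The augmentation ideal of the integral group ring `ℤG`. -/
noncomputable def augIdeal (G : Type*) [Group G] : Submodule ℤ (MonoidAlgebra ℤ G) :=
  Submodule.restrictScalars ℤ
    (RingHom.ker ((MonoidAlgebra.lift ℤ ℤ G) 1).toRingHom)

/-- The `n`-th dimension subgroup `δ_n(G) = {g ∈ G : g - 1 ∈ ϖ^n}`. -/
noncomputable def dimensionSubgroup (G : Type*) [Group G] (n : ℕ) : Set G :=
  {g : G | (MonoidAlgebra.of ℤ G g : MonoidAlgebra ℤ G) - 1 ∈ (augIdeal G) ^ n}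

/-- `γ_n(G)`, the `n`-th term of the lower central series, with `γ_1(G) = G`. -/
def gammaGrp (G : Type*) [Group G] (n : ℕ) : Subgroup G := Subgroup.lowerCentralSeries (⊤ : Subgroup G) (n - 1)

/-- Free group generators: `e_0, e_1, e_2` (indices `0,1,2`) and `z` (index `3`). -/
def fg (i : Fin 4) : FreeGroup (Fin 4) := FreeGroup.of i

/-- The relators `e_0^4·([z,e_1]·[z,e_2]^2)⁻¹`, `e_1^16·([z,e_0]⁻¹·[z,e_2]^4)⁻¹`,
`e_2^64·([z,e_0]⁻²·[z,e_1]⁻⁴)⁻¹`. -/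
def ripsRels : Set (FreeGroup (Fin 4)) :=
  {fg 0 ^ 4 * (⁅fg 3, fg 1⁆ * ⁅fg 3, fg 2⁆ ^ 2)⁻¹,
   fg 1 ^ 16 * (⁅fg 3, fg 0⁆⁻¹ * ⁅fg 3, fg 2⁆ ^ 4)⁻¹,
   fg 2 ^ 64 * (⁅fg 3, fg 0⁆⁻¹ ^ 2 * ⁅fg 3, fg 1⁆⁻¹ ^ 4)⁻¹}

/-- The group `G = ⟨e_0, e_1, e_2, z ∣ e_0^4 = [z,e_1][z,e_2]^2,
e_1^16 = [z,e_0]⁻¹[z,e_2]^4, e_2^64 = [z,e_0]⁻²[z,e_1]⁻⁴⟩`. -/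
def RipsGroup : Type := PresentedGroup ripsRels

instance : Group RipsGroup := inferInstanceAs (Group (PresentedGroup ripsRels))

/-- The images of the generators in `G`. -/
def eg (i : Fin 4) : RipsGroup := PresentedGroup.of i

lemma rips_ring {A : Type*} [Ring A] (I : Submodule ℤ A) (hII : I * I ≤ I)
    (X Y W Z t0 t1 t2 : A) (hX : X ∈ I) (hY : Y ∈ I) (hW : W ∈ I) (hZ : Z ∈ I)
    (h0 : t0 ∈ I ^ 3) (h1 : t1 ∈ I ^ 3) (h2 : t2 ∈ I ^ 3)
    (eX : 4 * X = (Z * Y - Y * Z) + 2 * (Z * W - W * Z) - 6 * (X * X) + t0)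
    (eY : 16 * Y = -(Z * X - X * Z) + 4 * (Z * W - W * Z) - 120 * (Y * Y) + t1)
    (eW : 64 * W = -2 * (Z * X - X * Z) - 4 * (Z * Y - Y * Z) - 2016 * (W * W) + t2) :
    (4 * X ∈ I ^ 2 ∧ 16 * Y ∈ I ^ 2) ∧
    32 * (X * Y - Y * X) + 64 * (X * W - W * X) + 128 * (Y * W - W * Y) ∈ I ^ 4 := by
  have m11 : ∀ {a b : A}, a ∈ I → b ∈ I → a * b ∈ I ^ 2 := by
    intro a b ha hb; rw [pow_two]; exact Submodule.mul_mem_mul ha hb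
  have m13 : ∀ {a b : A}, a ∈ I → b ∈ I ^ 3 → a * b ∈ I ^ 4 := by
    intro a b ha hb; rw [pow_succ' I 3]; exact Submodule.mul_mem_mul ha hb
  have m12 : ∀ {a b : A}, a ∈ I → b ∈ I ^ 2 → a * b ∈ I ^ 3 := by
    intro a b ha hb; rw [pow_succ' I 2]; exact Submodule.mul_mem_mul ha hb
  have m21 : ∀ {a b : A}, a ∈ I ^ 2 → b ∈ I → a * b ∈ I ^ 3 := by
    intro a b ha hb; rw [pow_succ I 2]; exact Submodule.mul_mem_mul ha hb
  have m22 : ∀ {a b : A}, a ∈ I ^ 2 → b ∈ I ^ 2 → a * b ∈ I ^ 4 := by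
    intro a b ha hb; rw [pow_add I 2 2]; exact Submodule.mul_mem_mul ha hb
  have le32 : I ^ 3 ≤ I ^ 2 := by
    rw [pow_succ' I 2, pow_two, ← mul_assoc]; exact mul_le_mul' hII le_rfl
  have nm : ∀ (k : ℕ) (n : ℕ) {a : A}, a ∈ I ^ k → (n : A) * a ∈ I ^ k := by
    intro k n a ha; rw [← nsmul_eq_mul]; exact Submodule.smul_of_tower_mem _ n ha
  have cm : ∀ {a b : A}, a ∈ I → b ∈ I → a * b - b * a ∈ I ^ 2 := fun ha hb =>
    sub_mem (m11 ha hb) (m11 hb ha)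
  have pX : 4 * X ∈ I ^ 2 := by
    rw [eX]
    exact add_mem (sub_mem (add_mem (cm hZ hY) (nm 2 2 (cm hZ hW))) (nm 2 6 (m11 hX hX))) (le32 h0)
  have pY : 16 * Y ∈ I ^ 2 := by
    rw [eY]
    exact add_mem (sub_mem (add_mem (neg_mem (cm hZ hX)) (nm 2 4 (cm hZ hW)))
      (nm 2 120 (m11 hY hY))) (le32 h1)
  have pW : 64 * W ∈ I ^ 2 := by
    rw [eW, neg_mul]
    exact add_mem (sub_mem (sub_mem (neg_mem (nm 2 2 (cm hZ hX))) (nm 2 4 (cm hZ hY)))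
      (nm 2 2016 (m11 hW hW))) (le32 h2)
  refine ⟨⟨pX, pY⟩, ?_⟩
  have key : 32 * (X * Y - Y * X) + 64 * (X * W - W * X) + 128 * (Y * W - W * Y)
      = 2 * (X * (16 * Y)) - 8 * (Y * (4 * X)) + X * (64 * W) - 16 * (W * (4 * X))
        + 2 * (Y * (64 * W)) - 8 * (W * (16 * Y)) := by noncomm_ring
  rw [key]
  rw [eX, eY, eW]
  have key2 : 2 * (X * (-(Z * X - X * Z) + 4 * (Z * W - W * Z) - 120 * (Y * Y) + t1))
      - 8 * (Y * ((Z * Y - Y * Z) + 2 * (Z * W - W * Z) - 6 * (X * X) + t0))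
      + X * (-2 * (Z * X - X * Z) - 4 * (Z * Y - Y * Z) - 2016 * (W * W) + t2)
      - 16 * (W * ((Z * Y - Y * Z) + 2 * (Z * W - W * Z) - 6 * (X * X) + t0))
      + 2 * (Y * (-2 * (Z * X - X * Z) - 4 * (Z * Y - Y * Z) - 2016 * (W * W) + t2))
      - 8 * (W * (-(Z * X - X * Z) + 4 * (Z * W - W * Z) - 120 * (Y * Y) + t1))
      = (4 * X) * (-(Z * X - X * Z) + (2:ℕ) * (Z * W - W * Z) - (60:ℕ) * (Y * Y)
            - (Z * Y - Y * Z) - (504:ℕ) * (W * W))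
        + (16 * Y) * (-(Z * Y - Y * Z) - (Z * W - W * Z) - (252:ℕ) * (W * W))
        + -((64 * W) * (Z * W - W * Z))
        + (12:ℕ) * (Y * ((4 * X) * X)) + (24:ℕ) * (W * ((4 * X) * X))
        + (60:ℕ) * (W * ((16 * Y) * Y))
        + -(W * (Z * (16 * Y) - (16 * Y) * Z))
        + -(Y * (Z * (4 * X) - (4 * X) * Z))
        + (2:ℕ) * (W * (Z * (4 * X) - (4 * X) * Z))
        + (2:ℕ) * (X * t1) + -((8:ℕ) * (Y * t0)) + X * t2 + -((16:ℕ) * (W * t0))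
        + (2:ℕ) * (Y * t2) + -((8:ℕ) * (W * t1)) := by
    push_cast
    noncomm_ring
  rw [key2]
  have c3 : ∀ {a b : A}, a ∈ I → b ∈ I ^ 2 → a * b - b * a ∈ I ^ 3 := fun ha hb =>
    sub_mem (m12 ha hb) (m21 hb ha)
  refine add_mem (add_mem (add_mem (add_mem (add_mem (add_mem (add_mem (add_mem (add_mem (add_mem
    (add_mem (add_mem (add_mem (add_mem ?_ ?_) ?_) ?_) ?_) ?_) ?_) ?_) ?_) ?_) ?_) ?_) ?_) ?_) ?_
  · exact m22 pX (sub_mem (sub_mem (sub_mem (add_mem (neg_mem (cm hZ hX)) (nm 2 2 (cm hZ hW)))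
      (nm 2 60 (m11 hY hY))) (cm hZ hY)) (nm 2 504 (m11 hW hW)))
  · exact m22 pY (sub_mem (sub_mem (neg_mem (cm hZ hY)) (cm hZ hW)) (nm 2 252 (m11 hW hW)))
  · exact neg_mem (m22 pW (cm hZ hW))
  · exact nm 4 _ (m13 hY (m21 pX hX))
  · exact nm 4 _ (m13 hW (m21 pX hX))
  · exact nm 4 _ (m13 hW (m21 pY hY))
  · exact neg_mem (m13 hW (c3 hZ pY))
  · exact neg_mem (m13 hY (c3 hZ pX))
  · exact nm 4 _ (m13 hW (c3 hZ pX))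
  · exact nm 4 _ (m13 hX h1)
  · exact neg_mem (nm 4 _ (m13 hY h0))
  · exact m13 hX h2
  · exact neg_mem (nm 4 _ (m13 hW h0))
  · exact nm 4 _ (m13 hY h2)
  · exact neg_mem (nm 4 _ (m13 hW h1))

@[ext] structure RQ where
  x0 : ℤ
  x1 : ℤ
  x2 : ℤ
  y0 : ℤ
  y1 : ℤ
  y2 : ℤ
  c : ℤ
  n : ℤ

namespace RQ

instance : Mul RQ := ⟨fun g h =>
  { x0 := g.x0 + h.x0, x1 := g.x1 + h.x1, x2 := g.x2 + h.x2
    y0 := g.y0 + h.y0 + g.n * h.x0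
    y1 := g.y1 + h.y1 + g.n * h.x1
    y2 := g.y2 + h.y2 + g.n * h.x2
    c := g.c + h.c + 4 * (g.x0 * h.x1 - g.x1 * h.x0) + 2 * (g.x0 * h.x2 - g.x2 * h.x0)
      + (g.x1 * h.x2 - g.x2 * h.x1)
      + 64 * (g.y0 * h.x0 - g.x0 * (h.y0 + g.n * h.x0))
      + 16 * (g.y1 * h.x1 - g.x1 * (h.y1 + g.n * h.x1))
      + 4 * (g.y2 * h.x2 - g.x2 * (h.y2 + g.n * h.x2))
    n := g.n + h.n }⟩
instance : One RQ := ⟨⟨0,0,0,0,0,0,0,0⟩⟩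
instance : Inv RQ := ⟨fun g =>
  ⟨-g.x0, -g.x1, -g.x2, -g.y0 + g.n * g.x0, -g.y1 + g.n * g.x1, -g.y2 + g.n * g.x2, -g.c, -g.n⟩⟩

lemma mul_def' (g h : RQ) : g * h =
  { x0 := g.x0 + h.x0, x1 := g.x1 + h.x1, x2 := g.x2 + h.x2
    y0 := g.y0 + h.y0 + g.n * h.x0
    y1 := g.y1 + h.y1 + g.n * h.x1
    y2 := g.y2 + h.y2 + g.n * h.x2
    c := g.c + h.c + 4 * (g.x0 * h.x1 - g.x1 * h.x0) + 2 * (g.x0 * h.x2 - g.x2 * h.x0)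
      + (g.x1 * h.x2 - g.x2 * h.x1)
      + 64 * (g.y0 * h.x0 - g.x0 * (h.y0 + g.n * h.x0))
      + 16 * (g.y1 * h.x1 - g.x1 * (h.y1 + g.n * h.x1))
      + 4 * (g.y2 * h.x2 - g.x2 * (h.y2 + g.n * h.x2))
    n := g.n + h.n } := rfl
lemma one_def' : (1 : RQ) = ⟨0,0,0,0,0,0,0,0⟩ := rfl
lemma inv_def' (g : RQ) : g⁻¹ =
  ⟨-g.x0, -g.x1, -g.x2, -g.y0 + g.n * g.x0, -g.y1 + g.n * g.x1, -g.y2 + g.n * g.x2, -g.c, -g.n⟩ := rfl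

instance : Group RQ := Group.ofLeftAxioms
  (by intro a b c; simp only [mul_def', RQ.mk.injEq]; refine ⟨?_,?_,?_,?_,?_,?_,?_,?_⟩ <;> ring)
  (by intro a; simp [mul_def', one_def'])
  (by intro a; simp only [mul_def', inv_def', one_def', RQ.mk.injEq];
      refine ⟨?_,?_,?_,?_,?_,?_,?_,?_⟩ <;> ring)

/-- images of the generators -/
def E : Fin 4 → RQ :=
  ![⟨1,0,0,0,0,0,0,0⟩, ⟨0,1,0,0,0,0,0,0⟩, ⟨0,0,1,0,0,0,0,0⟩, ⟨0,0,0,0,0,0,0,1⟩]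

lemma rel0 : E 0 ^ 4 * (⁅E 3, E 1⁆ * ⁅E 3, E 2⁆ ^ 2)⁻¹ = ⟨4,0,0,0,-1,-2,16+8,0⟩ := by
  simp [E, pow_succ, commutatorElement_def, mul_def', inv_def', one_def']
lemma rel1 : E 1 ^ 16 * (⁅E 3, E 0⁆⁻¹ * ⁅E 3, E 2⁆ ^ 4)⁻¹ = ⟨0,16,0,1,0,-4,-64+16,0⟩ := by
  simp [E, pow_succ, commutatorElement_def, mul_def', inv_def', one_def']
lemma rel2 : E 2 ^ 64 * (⁅E 3, E 0⁆⁻¹ ^ 2 * ⁅E 3, E 1⁆⁻¹ ^ 4)⁻¹ = ⟨0,0,64,2,4,0,-128-64,0⟩ := by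
  simp [E, pow_succ, commutatorElement_def, mul_def', inv_def', one_def']


/-- The normal subgroup generated by the relators (and `512` in the centre). -/
def K : Subgroup RQ where
  carrier := {g | g.n = 0 ∧ ∃ a0 a1 a2 b0 b1 b2 k : ℤ, g.x0 = 4 * a0 ∧ g.x1 = 16 * a1 ∧
    g.x2 = 64 * a2 ∧ g.y0 = a1 + 2 * a2 + 4 * b0 ∧ g.y1 = -a0 + 4 * a2 + 16 * b1 ∧
    g.y2 = -2 * a0 - 4 * a1 + 64 * b2 ∧
    g.c = 24 * a0 - 48 * a1 - 192 * a2 + 256 * a0 * a1 + 512 * k}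
  one_mem' := by
    refine ⟨rfl, 0, 0, 0, 0, 0, 0, 0, ?_⟩
    simp [one_def']
  mul_mem' := by
    rintro g h ⟨hn, a0, a1, a2, b0, b1, b2, k, h1, h2, h3, h4, h5, h6, h7⟩
      ⟨hn', a0', a1', a2', b0', b1', b2', k', h1', h2', h3', h4', h5', h6', h7'⟩
    refine ⟨by simp [mul_def', hn, hn'], a0 + a0', a1 + a1', a2 + a2', b0 + b0', b1 + b1', b2 + b2',
      k + k' - a0*a1' - (a0*a2'-a2*a0') - 2*(a1*a2'-a2*a1') - 2*(a0*b0'-b0*a0')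
        - 8*(a1*b1'-b1*a1') - 32*(a2*b2'-b2*a2'), ?_⟩
    simp only [mul_def', hn, h1, h2, h3, h4, h5, h6, h7, h1', h2', h3', h4', h5', h6', h7']
    refine ⟨?_, ?_, ?_, ?_, ?_, ?_, ?_⟩ <;> ring
  inv_mem' := by
    rintro g ⟨hn, a0, a1, a2, b0, b1, b2, k, h1, h2, h3, h4, h5, h6, h7⟩
    refine ⟨by simp [inv_def', hn], -a0, -a1, -a2, -b0, -b1, -b2, -k - a0 * a1, ?_⟩
    simp only [inv_def', hn, h1, h2, h3, h4, h5, h6, h7]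
    refine ⟨?_, ?_, ?_, ?_, ?_, ?_, ?_⟩ <;> ring

lemma mem_K (g : RQ) : g ∈ K ↔ (g.n = 0 ∧ ∃ a0 a1 a2 b0 b1 b2 k : ℤ, g.x0 = 4 * a0 ∧
    g.x1 = 16 * a1 ∧
    g.x2 = 64 * a2 ∧ g.y0 = a1 + 2 * a2 + 4 * b0 ∧ g.y1 = -a0 + 4 * a2 + 16 * b1 ∧
    g.y2 = -2 * a0 - 4 * a1 + 64 * b2 ∧
    g.c = 24 * a0 - 48 * a1 - 192 * a2 + 256 * a0 * a1 + 512 * k) := Iff.rfl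

instance : K.Normal := ⟨by
  rintro v ⟨hn, a0, a1, a2, b0, b1, b2, k, h1, h2, h3, h4, h5, h6, h7⟩ g
  refine ⟨by simp [mul_def', inv_def', hn], a0, a1, a2, b0 + g.n * a0, b1 + g.n * a1,
    b2 + g.n * a2, k + (g.y0 * a0 - g.x0 * (b0 + g.n * a0)) + (g.y1 * a1 - g.x1 * (b1 + g.n * a1))
      + (g.y2 * a2 - g.x2 * (b2 + g.n * a2)), ?_⟩
  simp only [mul_def', inv_def', hn, h1, h2, h3, h4, h5, h6, h7]
  refine ⟨?_, ?_, ?_, ?_, ?_, ?_, ?_⟩ <;> ring⟩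

/-- contains the derived subgroup -/
def G2 : Subgroup RQ where
  carrier := {g | g.x0 = 0 ∧ g.x1 = 0 ∧ g.x2 = 0 ∧ g.n = 0}
  one_mem' := ⟨rfl, rfl, rfl, rfl⟩
  mul_mem' := by
    rintro g h ⟨h1, h2, h3, h4⟩ ⟨h1', h2', h3', h4'⟩
    simp [mul_def', *]
  inv_mem' := by
    rintro g ⟨h1, h2, h3, h4⟩
    simp [inv_def', *]

/-- contains the third term -/
def G3 : Subgroup RQ where
  carrier := {g | g.x0 = 0 ∧ g.x1 = 0 ∧ g.x2 = 0 ∧ g.n = 0 ∧ g.y0 = 0 ∧ g.y1 = 0 ∧ g.y2 = 0}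
  one_mem' := ⟨rfl, rfl, rfl, rfl, rfl, rfl, rfl⟩
  mul_mem' := by
    rintro g h ⟨h1, h2, h3, h4, h5, h6, h7⟩ ⟨h1', h2', h3', h4', h5', h6', h7'⟩
    simp [mul_def', *]
  inv_mem' := by
    rintro g ⟨h1, h2, h3, h4, h5, h6, h7⟩
    simp [inv_def', *]

lemma lcs3 : Subgroup.lowerCentralSeries (⊤ : Subgroup RQ) 3 = ⊥ := by
  have l1 : Subgroup.lowerCentralSeries (⊤ : Subgroup RQ) 1 ≤ G2 := by
    rw [Subgroup.lowerCentralSeries_succ, Subgroup.commutator_le]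
    intro g _ h _
    refine ⟨?_, ?_, ?_, ?_⟩ <;> simp only [commutatorElement_def, mul_def', inv_def'] <;> ring
  have l2 : Subgroup.lowerCentralSeries (⊤ : Subgroup RQ) 2 ≤ G3 := by
    rw [Subgroup.lowerCentralSeries_succ]
    refine (Subgroup.commutator_mono l1 le_rfl).trans ?_
    rw [Subgroup.commutator_le]
    rintro g ⟨h1, h2, h3, h4⟩ h _
    refine ⟨?_, ?_, ?_, ?_, ?_, ?_, ?_⟩ <;>
      simp only [commutatorElement_def, mul_def', inv_def', h1, h2, h3, h4] <;> ring
  rw [eq_bot_iff, Subgroup.lowerCentralSeries_succ]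
  refine (Subgroup.commutator_mono l2 le_rfl).trans ?_
  rw [Subgroup.commutator_le]
  rintro g ⟨h1, h2, h3, h4, h5, h6, h7⟩ h _
  rw [Subgroup.mem_bot]
  simp only [commutatorElement_def, mul_def', inv_def', one_def', h1, h2, h3, h4, h5, h6, h7,
    RQ.mk.injEq]
  refine ⟨?_, ?_, ?_, ?_, ?_, ?_, ?_, ?_⟩ <;> ring

lemma central_pow (c : ℤ) (n : ℕ) :
    (⟨0,0,0,0,0,0,c,0⟩ : RQ) ^ n = ⟨0,0,0,0,0,0,n * c,0⟩ := by
  induction n with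
  | zero => simp [one_def']
  | succ n ih => rw [pow_succ, ih]; simp [mul_def']; ring

lemma alpha_eq : ⁅E 0, E 1⁆ ^ 32 * ⁅E 0, E 2⁆ ^ 64 * ⁅E 1, E 2⁆ ^ 128
    = ⟨0,0,0,0,0,0,768,0⟩ := by
  have h1 : ⁅E 0, E 1⁆ = ⟨0,0,0,0,0,0,8,0⟩ := by
    simp [E, commutatorElement_def, mul_def', inv_def']
  have h2 : ⁅E 0, E 2⁆ = ⟨0,0,0,0,0,0,4,0⟩ := by
    simp [E, commutatorElement_def, mul_def', inv_def']
  have h3 : ⁅E 1, E 2⁆ = ⟨0,0,0,0,0,0,2,0⟩ := by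
    simp [E, commutatorElement_def, mul_def', inv_def']
  rw [h1, h2, h3, central_pow, central_pow, central_pow]
  simp [mul_def']

lemma alpha_notMem : (⟨0,0,0,0,0,0,768,0⟩ : RQ) ∉ K := by
  rintro ⟨-, a0, a1, a2, b0, b1, b2, k, h1, h2, h3, -, -, -, h7⟩
  have e0 : a0 = 0 := by simpa using h1
  have e1 : a1 = 0 := by simpa using h2
  have e2 : a2 = 0 := by simpa using h3
  subst e0 e1 e2
  simp at h7
  omega

end RQ

/-- The map to the finite-type model. -/
def ripsF (i : Fin 4) : RQ ⧸ RQ.K := QuotientGroup.mk' RQ.K (RQ.E i)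

lemma ripsF_rels : ∀ r ∈ ripsRels, FreeGroup.lift ripsF r = 1 := by
  have key : ∀ r, FreeGroup.lift ripsF r = QuotientGroup.mk' RQ.K (FreeGroup.lift RQ.E r) := by
    intro r
    rw [← MonoidHom.comp_apply]
    congr 1
    ext i
    simp [ripsF]
  intro r hr
  rw [key, QuotientGroup.mk'_apply, QuotientGroup.eq_one_iff]
  rcases hr with rfl | rfl | rfl
  · simp only [fg, map_mul, map_inv, map_pow, map_commutatorElement, FreeGroup.lift_apply_of]
    rw [RQ.rel0]
    exact ⟨rfl, 1, 0, 0, 0, 0, 0, 0, by norm_num⟩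
  · simp only [fg, map_mul, map_inv, map_pow, map_commutatorElement, FreeGroup.lift_apply_of]
    rw [RQ.rel1]
    exact ⟨rfl, 0, 1, 0, 0, 0, 0, 0, by norm_num⟩
  · simp only [fg, map_mul, map_inv, map_pow, map_commutatorElement, FreeGroup.lift_apply_of]
    rw [RQ.rel2]
    exact ⟨rfl, 0, 0, 1, 0, 0, 0, 0, by norm_num⟩

/-- The homomorphism to the model. -/
def ripsHom : RipsGroup →* RQ ⧸ RQ.K := PresentedGroup.toGroup ripsF_rels

lemma ripsHom_eg (i : Fin 4) : ripsHom (eg i) = QuotientGroup.mk' RQ.K (RQ.E i) :=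
  PresentedGroup.toGroup.of ripsF_rels

lemma rips_notMem : (⁅eg 0, eg 1⁆ ^ 32 * ⁅eg 0, eg 2⁆ ^ 64 * ⁅eg 1, eg 2⁆ ^ 128)
      ∉ gammaGrp RipsGroup 4 := by
  intro h
  have h1 := Subgroup.mem_map_of_mem ripsHom h
  have h2 : (gammaGrp RipsGroup 4).map ripsHom ≤ ⊥ := by
    have : (⊤ : Subgroup (RQ ⧸ RQ.K)).lowerCentralSeries 3 = ⊥ := by
      have := Subgroup.map_lowerCentralSeries (⊤ : Subgroup RQ) (QuotientGroup.mk' RQ.K) 3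
      rw [RQ.lcs3, Subgroup.map_bot, Subgroup.map_top_of_surjective _
        (QuotientGroup.mk'_surjective _)] at this
      exact this.symm
    rw [← this]
    show (Subgroup.lowerCentralSeries (⊤ : Subgroup RipsGroup) 3).map ripsHom ≤ _
    rw [Subgroup.map_lowerCentralSeries]
    have mono : ∀ n, ((⊤ : Subgroup RipsGroup).map ripsHom).lowerCentralSeries n ≤
        (⊤ : Subgroup (RQ ⧸ RQ.K)).lowerCentralSeries n := by
      intro n
      induction n with
      | zero => exact le_top
      | succ n ih => exact Subgroup.commutator_mono ih le_top
    exact mono 3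
  have h3 := h2 h1
  rw [Subgroup.mem_bot] at h3
  simp only [map_mul, map_pow, map_commutatorElement, ripsHom_eg] at h3
  simp only [← map_mul, ← map_pow, ← map_commutatorElement] at h3
  rw [RQ.alpha_eq, QuotientGroup.mk'_apply, QuotientGroup.eq_one_iff] at h3
  exact RQ.alpha_notMem h3

section part1
variable {G A : Type*} [Group G] [Ring A]

/-- congruence of `g - 1` to `a` -/
def PC (o : G →* A) (I : Submodule ℤ A) (k : ℕ) (g : G) (a : A) : Prop :=
  o g - 1 ∈ I ^ 2 ∧ o g - 1 - a ∈ I ^ k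

lemma pow_anti (I : Submodule ℤ A) (hII : I * I ≤ I) (n k : ℕ) :
    I ^ (n + 1 + k) ≤ I ^ (n + 1) := by
  induction k with
  | zero => exact le_rfl
  | succ k ih =>
    refine le_trans ?_ ih
    rw [show n + 1 + (k + 1) = (n + k) + 1 + 1 by ring, show n + 1 + k = (n + k) + 1 by ring,
      pow_succ, pow_succ, mul_assoc]
    exact mul_le_mul' le_rfl hII

lemma nat_mul_mem' (S : Submodule ℤ A) (n : ℕ) {a : A} (ha : a ∈ S) : (n : A) * a ∈ S := by
  rw [← nsmul_eq_mul]; exact Submodule.smul_of_tower_mem _ n ha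

variable {o : G →* A} {I : Submodule ℤ A}

lemma PC.mul (hII : I * I ≤ I) {k : ℕ} (hk : I ^ 4 ≤ I ^ k) {g h : G} {a b : A}
    (hg : PC o I k g a) (hh : PC o I k h b) : PC o I k (g * h) (a + b) := by
  have e : o (g * h) - 1 = (o g - 1) + (o h - 1) + (o g - 1) * (o h - 1) := by
    rw [map_mul]; noncomm_ring
  have m : (o g - 1) * (o h - 1) ∈ I ^ 4 := by
    rw [pow_add I 2 2]; exact Submodule.mul_mem_mul hg.1 hh.1
  refine ⟨?_, ?_⟩
  · rw [e]; exact add_mem (add_mem hg.1 hh.1) (pow_anti I hII 1 2 m)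
  · have : o (g * h) - 1 - (a + b) = (o g - 1 - a) + (o h - 1 - b) + (o g - 1) * (o h - 1) := by
      rw [e]; abel
    rw [this]
    exact add_mem (add_mem hg.2 hh.2) (hk m)

lemma PC.inv (hI : ∀ g, o g - 1 ∈ I) (hII : I * I ≤ I) {k : ℕ} (hk : I ^ 4 ≤ I ^ k) {g : G} {a : A}
    (hg : PC o I k g a) : PC o I k g⁻¹ (-a) := by
  have e : o g⁻¹ - 1 = -(o g - 1) - (o g⁻¹ - 1) * (o g - 1) := by
    have : o g⁻¹ * o g = 1 := by rw [← map_mul]; simp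
    simp only [sub_mul, mul_sub, this, one_mul, mul_one]; abel
  have p : o g⁻¹ - 1 ∈ I ^ 2 := by
    rw [e]
    refine sub_mem (neg_mem hg.1) (pow_anti I hII 1 1 ?_)
    rw [pow_succ' I (1+1)]
    exact Submodule.mul_mem_mul (hI _) hg.1
  have m : (o g⁻¹ - 1) * (o g - 1) ∈ I ^ 4 := by
    rw [pow_add I 2 2]; exact Submodule.mul_mem_mul p hg.1
  refine ⟨p, ?_⟩
  have : o g⁻¹ - 1 - -a = -(o g - 1 - a) - (o g⁻¹ - 1) * (o g - 1) := by
    nth_rewrite 1 [e]; abel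
  rw [this]
  exact sub_mem (neg_mem hg.2) (hk m)

lemma PC.pow (hII : I * I ≤ I) {k : ℕ} (hk : I ^ 4 ≤ I ^ k) {g : G} {a : A}
    (hg : PC o I k g a) (n : ℕ) : PC o I k (g ^ n) (n * a) := by
  induction n with
  | zero => simp [PC]
  | succ n ih =>
    rw [pow_succ]
    have := ih.mul hII hk hg
    convert this using 1
    push_cast; rw [add_mul, one_mul]

lemma comm_eq (g h : G) : o ⁅g, h⁆ - 1 =
    ((o g - 1) * (o h - 1) - (o h - 1) * (o g - 1)) +
    ((o g - 1) * (o h - 1) - (o h - 1) * (o g - 1)) * (o (g⁻¹ * h⁻¹) - 1) := by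
  have e1 : o ⁅g, h⁆ = o g * o h * o (g⁻¹ * h⁻¹) := by
    rw [← map_mul, ← map_mul, commutatorElement_def]; congr 1; group
  have e2 : o h * o g * o (g⁻¹ * h⁻¹) = 1 := by
    rw [← map_mul, ← map_mul]; convert map_one o using 2; group
  have e3 : (o g - 1) * (o h - 1) - (o h - 1) * (o g - 1) = o g * o h - o h * o g := by
    noncomm_ring
  rw [e3, e1, mul_sub, mul_one, sub_mul, e2]; abel

lemma comm_mem (hI : ∀ g, o g - 1 ∈ I) (g h : G) :
    (o g - 1) * (o h - 1) - (o h - 1) * (o g - 1) ∈ I ^ 2 := by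
  rw [pow_two]
  exact sub_mem (Submodule.mul_mem_mul (hI _) (hI _)) (Submodule.mul_mem_mul (hI _) (hI _))

lemma PC.comm (hI : ∀ g, o g - 1 ∈ I) (hII : I * I ≤ I) (g h : G) :
    PC o I 3 ⁅g, h⁆ ((o g - 1) * (o h - 1) - (o h - 1) * (o g - 1)) := by
  have m : ((o g - 1) * (o h - 1) - (o h - 1) * (o g - 1)) * (o (g⁻¹ * h⁻¹) - 1) ∈ I ^ 3 := by
    rw [pow_succ I 2]; exact Submodule.mul_mem_mul (comm_mem hI g h) (hI _)
  refine ⟨?_, ?_⟩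
  · rw [comm_eq]
    exact add_mem (comm_mem hI g h) (pow_anti I hII 1 1 m)
  · rw [comm_eq, add_sub_cancel_left]; exact m

lemma pow_expand (hI : ∀ g, o g - 1 ∈ I) (hII : I * I ≤ I) (g : G) (n : ℕ) :
    o (g ^ n) - 1 - n * (o g - 1) ∈ I ^ 2 ∧
    o (g ^ n) - 1 - n * (o g - 1) - (n.choose 2 : ℕ) * ((o g - 1) * (o g - 1)) ∈ I ^ 3 := by
  induction n with
  | zero => simp
  | succ n ih =>
    have e : o (g ^ (n + 1)) - 1 = (o (g ^ n) - 1) + (o g - 1) + (o (g ^ n) - 1) * (o g - 1) := by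
      rw [pow_succ, map_mul]; noncomm_ring
    constructor
    · have : o (g ^ (n + 1)) - 1 - (n + 1 : ℕ) * (o g - 1) =
          (o (g ^ n) - 1 - n * (o g - 1)) + (o (g ^ n) - 1) * (o g - 1) := by
        rw [e]; push_cast; rw [add_mul, one_mul]; abel
      rw [this]
      refine add_mem ih.1 ?_
      rw [pow_two]; exact Submodule.mul_mem_mul (hI _) (hI _)
    · have : o (g ^ (n + 1)) - 1 - (n + 1 : ℕ) * (o g - 1)
            - ((n + 1).choose 2 : ℕ) * ((o g - 1) * (o g - 1)) =
          (o (g ^ n) - 1 - n * (o g - 1) - (n.choose 2 : ℕ) * ((o g - 1) * (o g - 1)))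
            + (o (g ^ n) - 1 - n * (o g - 1)) * (o g - 1) := by
        rw [e, Nat.choose_succ_succ' n 1, Nat.choose_one_right]
        push_cast
        simp only [add_mul, one_mul, sub_mul _ _ (o g - 1), mul_assoc]
        abel
      rw [this]
      refine add_mem ih.2 ?_
      rw [pow_succ I 2]; exact Submodule.mul_mem_mul ih.1 (hI _)

lemma rel_expand (hI : ∀ g, o g - 1 ∈ I) (hII : I * I ≤ I) {g h : G} {a : A} (n : ℕ)
    (hg : g ^ n = h) (hh : PC o I 3 h a) :
    n * (o g - 1) - a + (n.choose 2 : ℕ) * ((o g - 1) * (o g - 1)) ∈ I ^ 3 := by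
  have h1 := (pow_expand hI hII g n).2
  rw [hg] at h1
  have := sub_mem hh.2 h1
  convert this using 1
  abel

lemma part1_abs (hI : ∀ g, o g - 1 ∈ I) (hII : I * I ≤ I) (e : Fin 4 → G)
    (r0 : e 0 ^ 4 = ⁅e 3, e 1⁆ * ⁅e 3, e 2⁆ ^ 2)
    (r1 : e 1 ^ 16 = ⁅e 3, e 0⁆⁻¹ * ⁅e 3, e 2⁆ ^ 4)
    (r2 : e 2 ^ 64 = ⁅e 3, e 0⁆⁻¹ ^ 2 * ⁅e 3, e 1⁆⁻¹ ^ 4) :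
    o (⁅e 0, e 1⁆ ^ 32 * ⁅e 0, e 2⁆ ^ 64 * ⁅e 1, e 2⁆ ^ 128) - 1 ∈ I ^ 4 := by
  have h43 : I ^ 4 ≤ I ^ 3 := pow_anti I hII 2 1
  have c := PC.comm hI hII
  have t0 := rel_expand hI hII 4 r0 ((c _ _).mul hII h43 ((c _ _).pow hII h43 2))
  have t1 := rel_expand hI hII 16 r1 (((c _ _).inv hI hII h43).mul hII h43 ((c _ _).pow hII h43 4))
  have t2 := rel_expand hI hII 64 r2 ((((c _ _).inv hI hII h43).pow hII h43 2).mul hII h43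
    (((c _ _).inv hI hII h43).pow hII h43 4))
  obtain ⟨⟨pX, pY⟩, main⟩ := rips_ring I hII (o (e 0) - 1) (o (e 1) - 1) (o (e 2) - 1) (o (e 3) - 1)
    _ _ _ (hI _) (hI _) (hI _) (hI _) t0 t1 t2
    (by simp only [Nat.choose_two_right]; norm_num)
    (by simp only [Nat.choose_two_right]; norm_num)
    (by simp only [Nat.choose_two_right, mul_neg, neg_mul]; norm_num; abel)
  have c4 : ∀ g h, PC o I 4 ⁅g, h⁆ (o ⁅g, h⁆ - 1) := fun g h => ⟨(c g h).1, by simp⟩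
  have fin := ((((c4 (e 0) (e 1)).pow hII le_rfl 32).mul hII le_rfl
    ((c4 (e 0) (e 2)).pow hII le_rfl 64)).mul hII le_rfl ((c4 (e 1) (e 2)).pow hII le_rfl 128)).2
  have cube : ∀ (n m : ℕ) (g h : G), (n : A) * (o g - 1) ∈ I ^ 2 →
      (m * n : ℕ) * (((o g - 1) * (o h - 1) - (o h - 1) * (o g - 1)) * (o (g⁻¹ * h⁻¹) - 1)) ∈ I ^ 4 := by
    intro n m g h hn
    have : ((m * n : ℕ) : A) *
        (((o g - 1) * (o h - 1) - (o h - 1) * (o g - 1)) * (o (g⁻¹ * h⁻¹) - 1)) =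
        m * (((n * (o g - 1)) * (o h - 1) - (o h - 1) * (n * (o g - 1))) * (o (g⁻¹ * h⁻¹) - 1)) := by
      generalize o g - 1 = x
      generalize o h - 1 = y
      generalize o (g⁻¹ * h⁻¹) - 1 = w
      rw [← mul_assoc y, ← Nat.cast_comm n y]
      push_cast
      simp only [mul_assoc, sub_mul, mul_sub]
    rw [this]
    refine nat_mul_mem' _ _ ?_
    rw [pow_succ I 3, pow_succ I 2]
    refine Submodule.mul_mem_mul (sub_mem (Submodule.mul_mem_mul hn (hI _)) ?_) (hI _)
    rw [← pow_succ I 2, pow_succ' I 2]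
    exact Submodule.mul_mem_mul (hI _) hn
  have u1 := cube 4 8 (e 0) (e 1) (by exact_mod_cast pX)
  have u2 := cube 4 16 (e 0) (e 2) (by exact_mod_cast pX)
  have u3 := cube 16 8 (e 1) (e 2) (by exact_mod_cast pY)
  rw [comm_eq (e 0) (e 1), comm_eq (e 0) (e 2), comm_eq (e 1) (e 2)] at fin
  have := add_mem fin (add_mem main (add_mem u1 (add_mem u2 u3)))
  convert this using 1
  norm_num
  simp only [mul_add]
  abel

end part1

lemma aug_sub (G : Type*) [Group G] (g : G) : MonoidAlgebra.of ℤ G g - 1 ∈ augIdeal G := by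
  simp [augIdeal, RingHom.mem_ker]

lemma aug_mul (G : Type*) [Group G] : augIdeal G * augIdeal G ≤ augIdeal G := by
  rw [Submodule.mul_le]
  intro a _ b hb
  exact Ideal.mul_mem_left _ a hb

lemma eg_rel {r : FreeGroup (Fin 4)} (hr : r ∈ ripsRels) :
    FreeGroup.lift eg r = 1 := by
  have : FreeGroup.lift eg = (PresentedGroup.mk ripsRels : FreeGroup (Fin 4) →* PresentedGroup ripsRels) := by
    ext i; simp; rfl
  rw [this]
  exact PresentedGroup.one_of_mem hr

/-- The element `α = [e_0,e_1]^32·[e_0,e_2]^64·[e_1,e_2]^128` lies in `δ_4(G)` but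
not in `γ_4(G)`. -/
theorem rips_group_dimension_quotient :
    (⁅eg 0, eg 1⁆ ^ 32 * ⁅eg 0, eg 2⁆ ^ 64 * ⁅eg 1, eg 2⁆ ^ 128)
      ∈ dimensionSubgroup RipsGroup 4 ∧
    (⁅eg 0, eg 1⁆ ^ 32 * ⁅eg 0, eg 2⁆ ^ 64 * ⁅eg 1, eg 2⁆ ^ 128)
      ∉ gammaGrp RipsGroup 4 := by
  refine ⟨?_, rips_notMem⟩
  refine part1_abs (aug_sub RipsGroup) (aug_mul RipsGroup) eg ?_ ?_ ?_
  · have := eg_rel (r := fg 0 ^ 4 * (⁅fg 3, fg 1⁆ * ⁅fg 3, fg 2⁆ ^ 2)⁻¹) (by simp [ripsRels])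
    simp only [fg, map_mul, map_inv, map_pow, map_commutatorElement, FreeGroup.lift_apply_of] at this
    exact mul_inv_eq_one.mp this
  · have := eg_rel (r := fg 1 ^ 16 * (⁅fg 3, fg 0⁆⁻¹ * ⁅fg 3, fg 2⁆ ^ 4)⁻¹) (by simp [ripsRels])
    simp only [fg, map_mul, map_inv, map_pow, map_commutatorElement, FreeGroup.lift_apply_of] at this
    exact mul_inv_eq_one.mp this
  · have := eg_rel (r := fg 2 ^ 64 * (⁅fg 3, fg 0⁆⁻¹ ^ 2 * ⁅fg 3, fg 1⁆⁻¹ ^ 4)⁻¹)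
      (by simp [ripsRels])
    simp only [fg, map_mul, map_inv, map_pow, map_commutatorElement, FreeGroup.lift_apply_of] at this
    exact mul_inv_eq_one.mp this
end
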